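/- arXiv:2402.11639 — 3 statements merged into one kernel-verified Lean document; each statement's English description precedes it below -/
import Mathlib

section
/- (Learning Lipschitzness suffices for generalization.) There exists N0 > 0 depending only on d and, for every pair of reals 0 < a ≤ b, a constant C > 0 depending only on d, a, b, such that: if L, σ > 0 and n ≥ N0·(1 + (L·log n/σ)^d), then for every scalar w with a·Λ^{1/(d+2)} ≤ w ≤ b·Λ^{2/(d+2)} and 45·√d·w^{d/2} ≤ n/log n, and for every L-Lipschitz function f : S^{d−1} → ℝ, the ICL test loss satisfies L_f(w·I_d) ≤ C·L²·Λ^{−1/(d+2)}. -/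
open MeasureTheory Real

noncomputable section

/-- Uniform probability measure on the unit sphere `S^{d-1} ⊆ ℝ^d`, defined as the
normalized `(d-1)`-dimensional Hausdorff measure restricted to the sphere. -/
def sphereUniform (d : ℕ) : Measure (EuclideanSpace ℝ (Fin d)) :=
  ((μH[(d : ℝ) - 1]) (Metric.sphere (0 : EuclideanSpace ℝ (Fin d)) 1))⁻¹ •
    (μH[(d : ℝ) - 1]).restrict (Metric.sphere (0 : EuclideanSpace ℝ (Fin d)) 1)

/-- Uniform probability measure on the interval `[-L, L]`. -/
def unifIcc (L : ℝ) : Measure ℝ :=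
  (ENNReal.ofReal (2 * L))⁻¹ • (volume.restrict (Set.Icc (-L) L))

/-- The bilinear form `x ↦ x ⬝ M y`. -/
def quadForm {d : ℕ} (M : Matrix (Fin d) (Fin d) ℝ)
    (x y : EuclideanSpace ℝ (Fin d)) : ℝ :=
  ∑ a, ∑ b, x a * M a b * y b

/-- The softmax-attention prediction of the label of the query `x (Fin.last n)` given
the context points `x i` with labels `y i`, `i = 1, …, n`. -/
def softmaxPred {d n : ℕ} (M : Matrix (Fin d) (Fin d) ℝ)
    (x : Fin (n + 1) → EuclideanSpace ℝ (Fin d)) (y : Fin n → ℝ) : ℝ :=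
  (∑ i : Fin n, y i * Real.exp (quadForm M (x i.castSucc) (x (Fin.last n)))) /
    ∑ i : Fin n, Real.exp (quadForm M (x i.castSucc) (x (Fin.last n)))

/-- The softmax-attention ICL pretraining population loss: the task parameter `θ` is drawn
from `τ`, the covariates `x_1, …, x_{n+1}` are i.i.d. `sphereUniform d`, and the label
noises `e_1, …, e_n` are i.i.d. with law `ν`; the loss is the expected squared error of the
softmax-attention prediction of the clean label `F θ (x_{n+1})` of the query from the noisy
labelled context `{(x_i, F θ x_i + e_i)}_{i=1}^n`. -/
def iclLoss (d n : ℕ) {Θ : Type*} [MeasurableSpace Θ] (τ : Measure Θ) (ν : Measure ℝ)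
    (F : Θ → EuclideanSpace ℝ (Fin d) → ℝ) (M : Matrix (Fin d) (Fin d) ℝ) : ℝ :=
  ∫ θ, ∫ x : Fin (n + 1) → EuclideanSpace ℝ (Fin d), ∫ e : Fin n → ℝ,
      (softmaxPred M x (fun i => F θ (x i.castSucc) + e i) - F θ (x (Fin.last n))) ^ 2
        ∂(Measure.pi fun _ : Fin n => ν)
      ∂(Measure.pi fun _ : Fin (n + 1) => sphereUniform d) ∂τ

/-- The parameter distribution of the affine task class `D(F^aff_L)`:
`v` uniform on the sphere, `l, b` i.i.d. uniform on `[-L, L]`. -/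
def affineTask (d : ℕ) (L : ℝ) : Measure (EuclideanSpace ℝ (Fin d) × ℝ × ℝ) :=
  (sphereUniform d).prod ((unifIcc L).prod (unifIcc L))

/-- The affine task function `f(x) = l ⬝ vᵀx + b` with parameter `θ = (v, l, b)`. -/
def affineF {d : ℕ} (θ : EuclideanSpace ℝ (Fin d) × ℝ × ℝ)
    (x : EuclideanSpace ℝ (Fin d)) : ℝ :=
  θ.2.1 * (∑ a, θ.1 a * x a) + θ.2.2

/-- The ICL test loss of the attention matrix `M` on the fixed task `f`: the covariates
`x_1, …, x_{n+1}` are i.i.d. `sphereUniform d` and the label noises are i.i.d. `ν`. -/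
def testLoss (d n : ℕ) (ν : Measure ℝ) (f : EuclideanSpace ℝ (Fin d) → ℝ)
    (M : Matrix (Fin d) (Fin d) ℝ) : ℝ :=
  ∫ x : Fin (n + 1) → EuclideanSpace ℝ (Fin d), ∫ e : Fin n → ℝ,
      (softmaxPred M x (fun i => f (x i.castSucc) + e i) - f (x (Fin.last n))) ^ 2
        ∂(Measure.pi fun _ : Fin n => ν)
      ∂(Measure.pi fun _ : Fin (n + 1) => sphereUniform d)

/-- Lebesgue measure of a spherical shell centred at the origin. -/
lemma volume_shell {d : ℕ} (hd : 1 ≤ d) {s : ℝ} (hs : 0 ≤ s) (hs1 : s ≤ 1) :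
    volume (Metric.ball (0 : EuclideanSpace ℝ (Fin d)) (1 + s) \ Metric.closedBall 0 (1 - s)) =
      ENNReal.ofReal ((1 + s) ^ d - (1 - s) ^ d) *
        volume (Metric.ball (0 : EuclideanSpace ℝ (Fin d)) 1) := by
  have : Nonempty (Fin d) := ⟨⟨0, hd⟩⟩
  have hV : volume (Metric.ball (0 : EuclideanSpace ℝ (Fin d)) 1) ≠ ⊤ :=
    measure_ball_lt_top.ne
  have hfin : volume (Metric.closedBall (0 : EuclideanSpace ℝ (Fin d)) (1 - s)) ≠ ⊤ :=
    measure_closedBall_lt_top.ne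
  rcases eq_or_lt_of_le hs with rfl | hs0
  · have : Metric.ball (0 : EuclideanSpace ℝ (Fin d)) (1 + 0) \ Metric.closedBall 0 (1 - 0) = ∅ := by
      rw [Set.sdiff_eq_empty]
      simpa using Metric.ball_subset_closedBall
    rw [this]
    simp
  rw [measure_sdiff (fun x hx => by
      simp only [Metric.mem_closedBall, Metric.mem_ball] at *; linarith)
    measurableSet_closedBall.nullMeasurableSet hfin,
    Measure.addHaar_closedBall _ _ (by linarith), Measure.addHaar_ball _ _ (by linarith),
    finrank_euclideanSpace_fin, ENNReal.ofReal_sub _ (pow_nonneg (by linarith) _),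
    ENNReal.sub_mul (fun _ _ => hV)]

lemma sphereUniform_eq_zero_or_isProbabilityMeasure (d : ℕ) :
    sphereUniform d = 0 ∨ IsProbabilityMeasure (sphereUniform d) := by
  unfold sphereUniform
  set m := (μH[(d : ℝ) - 1]) (Metric.sphere (0 : EuclideanSpace ℝ (Fin d)) 1) with hm
  by_cases h0 : m = 0
  · left
    rw [Measure.restrict_eq_zero.2 h0, smul_zero]
  by_cases h1 : m = ⊤
  · left
    simp [h1]
  · right
    constructor
    rw [Measure.smul_apply, Measure.restrict_apply_univ, smul_eq_mul, ← hm,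
      ENNReal.inv_mul_cancel h0 h1]

lemma ae_norm_eq_one_sphereUniform (d : ℕ) : ∀ᵐ x ∂sphereUniform d, ‖x‖ = 1 := by
  refine Measure.ae_smul_measure ?_ _
  filter_upwards [ae_restrict_mem (Metric.isClosed_sphere.measurableSet)] with x hx
  simpa using hx

lemma measurePreserving_sphereUniform {d : ℕ}
    (T : EuclideanSpace ℝ (Fin d) ≃ₗᵢ[ℝ] EuclideanSpace ℝ (Fin d)) :
    MeasurePreserving T (sphereUniform d) (sphereUniform d) := by
  have h := (T.toIsometryEquiv.measurePreserving_hausdorffMeasure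
    ((d : ℝ) - 1)).restrict_preimage
      (Metric.isClosed_sphere (x := (0 : EuclideanSpace ℝ (Fin d))) (ε := 1)).measurableSet
  have hpre : T.toIsometryEquiv ⁻¹' Metric.sphere (0 : EuclideanSpace ℝ (Fin d)) 1 =
      Metric.sphere 0 1 := by
    ext x; simp
  rw [hpre] at h
  refine ⟨T.continuous.measurable, ?_⟩
  have h2 := h.map_eq
  unfold sphereUniform
  rw [Measure.map_smul]
  congr 1

/-- Rotation invariance: radial integrals around points of the sphere do not depend on the
point. -/
lemma lintegral_dist_sphereUniform_eq {d : ℕ} (g : ℝ → ENNReal) (hg : Measurable g)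
    {z z' : EuclideanSpace ℝ (Fin d)} (hz : ‖z‖ = 1) (hz' : ‖z'‖ = 1) :
    ∫⁻ x, g ‖x - z‖ ∂sphereUniform d = ∫⁻ x, g ‖x - z'‖ ∂sphereUniform d := by
  set T := (ℝ ∙ (z - z'))ᗮ.reflection with hT
  have hTz : T z = z' := Submodule.reflection_sub (by rw [hz, hz'])
  rw [← (measurePreserving_sphereUniform T).lintegral_comp (f := fun x => g ‖x - z'‖)
    (by fun_prop)]
  refine lintegral_congr fun x => ?_
  rw [← hTz, ← map_sub, LinearIsometryEquiv.norm_map]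

lemma integral_dist_sphereUniform_eq {d : ℕ} (g : ℝ → ℝ)
    {z z' : EuclideanSpace ℝ (Fin d)} (hz : ‖z‖ = 1) (hz' : ‖z'‖ = 1) :
    ∫ x, g ‖x - z‖ ∂sphereUniform d = ∫ x, g ‖x - z'‖ ∂sphereUniform d := by
  set T := (ℝ ∙ (z - z'))ᗮ.reflection with hT
  have hTz : T z = z' := Submodule.reflection_sub (by rw [hz, hz'])
  rw [← (measurePreserving_sphereUniform T).integral_comp
    T.toHomeomorph.measurableEmbedding (fun x => g ‖x - z'‖)]
  refine integral_congr_ae (.of_forall fun x => ?_)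
  simp only
  rw [← hTz, ← map_sub, LinearIsometryEquiv.norm_map]

/-- Spherical caps of radius `2 s` have measure at least of order `s ^ (d - 1)`. -/
lemma pow_le_sphereUniform_ball {d : ℕ} (hd : 1 ≤ d) [IsProbabilityMeasure (sphereUniform d)]
    {s : ℝ} (hs : 0 < s) (hs1 : s ≤ 1) {z : EuclideanSpace ℝ (Fin d)} (hz : ‖z‖ = 1) :
    s ^ (d - 1) ≤ d * 2 ^ d * (sphereUniform d).real (Metric.ball z (2 * s)) := by
  have : Nonempty (Fin d) := ⟨⟨0, hd⟩⟩
  set μ := sphereUniform d with hμ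
  set A : Set (EuclideanSpace ℝ (Fin d)) :=
    Metric.ball 0 (1 + s) \ Metric.closedBall 0 (1 - s) with hA
  set V := volume (Metric.ball (0 : EuclideanSpace ℝ (Fin d)) 1) with hV
  have hV0 : V ≠ 0 := (Metric.measure_ball_pos _ _ one_pos).ne'
  have hVt : V ≠ ⊤ := measure_ball_lt_top.ne
  have hball : ∀ z' : EuclideanSpace ℝ (Fin d), ‖z'‖ = 1 →
      μ (Metric.ball z' (2 * s)) = μ (Metric.ball z (2 * s)) := by
    intro z' hz'
    have := lintegral_dist_sphereUniform_eq ((Set.Iio (2 * s)).indicator 1)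
      (measurable_one.indicator measurableSet_Iio) hz' hz
    have key : ∀ y : EuclideanSpace ℝ (Fin d),
        ∫⁻ x, (Set.Iio (2 * s)).indicator 1 ‖x - y‖ ∂sphereUniform d =
          μ (Metric.ball y (2 * s)) := by
      intro y
      rw [← lintegral_indicator_one measurableSet_ball]
      refine lintegral_congr fun x => ?_
      simp [Set.indicator, dist_eq_norm]
    rwa [key, key] at this
  set S : Set (EuclideanSpace ℝ (Fin d) × EuclideanSpace ℝ (Fin d)) :=
    {p | dist p.1 p.2 < s} with hS
  have hSm : MeasurableSet S := (isOpen_lt continuous_dist continuous_const).measurableSet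
  have h1 : (μ.prod volume) S = ENNReal.ofReal (s ^ d) * V := by
    rw [Measure.prod_apply hSm]
    have : ∀ x : EuclideanSpace ℝ (Fin d), volume (Prod.mk x ⁻¹' S) =
        ENNReal.ofReal (s ^ d) * V := by
      intro x
      have : Prod.mk x ⁻¹' S = Metric.ball x s := by
        ext y; simp [hS, dist_comm]
      rw [this, Measure.addHaar_ball _ _ hs.le, finrank_euclideanSpace_fin]
    simp [this]
  have h2 : (μ.prod volume) S ≤ μ (Metric.ball z (2 * s)) * volume A := by
    rw [Measure.prod_apply_symm hSm]
    have hAm : MeasurableSet A := measurableSet_ball.diff measurableSet_closedBall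
    rw [← lintegral_indicator_const hAm]
    refine lintegral_mono fun y => ?_
    have hpre : (fun x => (x, y)) ⁻¹' S = Metric.ball y s := by
      ext x; simp [hS]
    rw [hpre]
    by_cases h0 : μ (Metric.ball y s) = 0
    · rw [h0]; exact zero_le
    obtain ⟨x, hxs, hx1⟩ : ∃ x ∈ Metric.ball y s, ‖x‖ = 1 := by
      by_contra! hcon
      apply h0
      refine measure_mono_null (fun x hx => ?_) (ae_norm_eq_one_sphereUniform d)
      exact hcon x hx
    have hxy : ‖x - y‖ < s := by simpa [dist_eq_norm] using hxs
    have hyA : y ∈ A := by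
      have a1 := norm_sub_norm_le x y
      have a2 := norm_sub_norm_le y x
      rw [norm_sub_rev] at a2
      simp only [hA, Set.mem_sdiff, Metric.mem_ball, Metric.mem_closedBall, dist_zero_right, not_le]
      constructor <;> linarith
    rw [Set.indicator_of_mem hyA, ← hball x hx1]
    refine measure_mono fun u hu => ?_
    have := dist_triangle u y x
    simp only [Metric.mem_ball] at *
    rw [dist_comm y x] at this
    linarith
  rw [h1, volume_shell hd hs.le hs1, ← mul_assoc] at h2
  have h3 := (ENNReal.mul_le_mul_iff_left hV0 hVt).1 h2
  rw [← ofReal_measureReal, ← ENNReal.ofReal_mul measureReal_nonneg] at h3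
  have hsub : 0 ≤ (1 + s) ^ d - (1 - s) ^ d := by
    have := pow_le_pow_left₀ (by linarith : 0 ≤ 1 - s) (by linarith : 1 - s ≤ 1 + s) d
    linarith
  have h4 := (ENNReal.ofReal_le_ofReal_iff (mul_nonneg measureReal_nonneg hsub)).1 h3
  have h5 : (1 + s) ^ d - (1 - s) ^ d ≤ s * (d * 2 ^ d) := by
    have := abs_pow_sub_pow_le (1 + s) (1 - s) d
    rw [abs_of_nonneg hsub, abs_of_nonneg (by linarith : 0 ≤ 1 + s),
      abs_of_nonneg (by linarith : 0 ≤ 1 - s), max_eq_left (by linarith),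
      abs_of_nonneg (by linarith)] at this
    refine this.trans ?_
    calc (1 + s - (1 - s)) * d * (1 + s) ^ (d - 1) ≤ (1 + s - (1 - s)) * d * 2 ^ (d - 1) := by
          have : 0 ≤ 1 + s - (1 - s) := by linarith
          gcongr; linarith
      _ = s * (d * (2 ^ (d - 1) * 2)) := by ring
      _ = _ := by rw [← pow_succ, Nat.sub_add_cancel hd]
  have h6 : s * s ^ (d - 1) ≤ s * (d * 2 ^ d * μ.real (Metric.ball z (2 * s))) := by
    rw [← pow_succ', Nat.sub_add_cancel hd]
    refine h4.trans ((mul_le_mul_of_nonneg_left h5 measureReal_nonneg).trans_eq (by ring))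
  exact le_of_mul_le_mul_left h6 hs

/-- The mean over the sphere of the Gaussian weight of inverse bandwidth `w` centred at `z`. -/
def sphereGauss (d : ℕ) (w : ℝ) (z : EuclideanSpace ℝ (Fin d)) : ℝ :=
  ∫ x, Real.exp (-w * ‖x - z‖ ^ 2 / 2) ∂sphereUniform d

lemma sphereGauss_eq {d : ℕ} (w : ℝ) {z z' : EuclideanSpace ℝ (Fin d)}
    (hz : ‖z‖ = 1) (hz' : ‖z'‖ = 1) : sphereGauss d w z = sphereGauss d w z' :=
  integral_dist_sphereUniform_eq (fun t => Real.exp (-w * t ^ 2 / 2)) hz hz'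

lemma integrable_gauss {d : ℕ} [IsProbabilityMeasure (sphereUniform d)] {w : ℝ} (hw : 0 ≤ w)
    (z : EuclideanSpace ℝ (Fin d)) :
    Integrable (fun x => Real.exp (-w * ‖x - z‖ ^ 2 / 2)) (sphereUniform d) := by
  refine Integrable.of_bound (C := 1) (by fun_prop) (.of_forall fun x => ?_)
  rw [Real.norm_eq_abs, abs_of_pos (Real.exp_pos _), Real.exp_le_one_iff]
  nlinarith [mul_nonneg hw (sq_nonneg ‖x - z‖)]

lemma sphereGauss_anti {d : ℕ} [IsProbabilityMeasure (sphereUniform d)] {v w : ℝ} (hv : 0 ≤ v)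
    (hvw : v ≤ w) (z : EuclideanSpace ℝ (Fin d)) : sphereGauss d w z ≤ sphereGauss d v z := by
  refine integral_mono (integrable_gauss (hv.trans hvw) z) (integrable_gauss hv z) fun x => ?_
  refine Real.exp_le_exp.2 ?_
  nlinarith [mul_le_mul_of_nonneg_right hvw (sq_nonneg ‖x - z‖)]

lemma sphereGauss_le_one {d : ℕ} [IsProbabilityMeasure (sphereUniform d)] {w : ℝ} (hw : 0 ≤ w)
    (z : EuclideanSpace ℝ (Fin d)) : sphereGauss d w z ≤ 1 := by
  refine (sphereGauss_anti le_rfl hw z).trans_eq ?_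
  simp [sphereGauss]

lemma exp_le_sphereGauss {d : ℕ} [IsProbabilityMeasure (sphereUniform d)] {w : ℝ} (hw : 0 ≤ w)
    {z : EuclideanSpace ℝ (Fin d)} (hz : ‖z‖ = 1) : Real.exp (-2 * w) ≤ sphereGauss d w z := by
  have h : ∫ _ : EuclideanSpace ℝ (Fin d), Real.exp (-2 * w) ∂sphereUniform d ≤
      sphereGauss d w z := by
    refine integral_mono_ae (integrable_const _) (integrable_gauss hw z) ?_
    filter_upwards [ae_norm_eq_one_sphereUniform d] with x hx
    refine Real.exp_le_exp.2 ?_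
    have h1 := norm_sub_le x z
    rw [hx, hz] at h1
    have h2 : ‖x - z‖ ^ 2 ≤ 4 := by nlinarith [norm_nonneg (x - z)]
    nlinarith
  simpa using h

/-- Lower bound for the Gaussian mean, of the optimal order. -/
lemma exists_le_sphereGauss {d : ℕ} (hd : 1 ≤ d) [IsProbabilityMeasure (sphereUniform d)] :
    ∃ c : ℝ, 0 < c ∧ ∀ w : ℝ, 1 ≤ w → ∀ z : EuclideanSpace ℝ (Fin d), ‖z‖ = 1 →
      c ≤ sphereGauss d w z * √w ^ (d - 1) := by
  have hd0 : (0 : ℝ) < d := by exact_mod_cast hd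
  refine ⟨Real.exp (-2) / (d * 2 ^ d), by positivity, fun w hw z hz => ?_⟩
  have hsq : 1 ≤ √w := Real.one_le_sqrt.2 hw
  have hs0 : 0 < √w := by linarith
  have hww : √w ^ 2 = w := Real.sq_sqrt (by linarith)
  have h1 := pow_le_sphereUniform_ball hd (s := (√w)⁻¹) (by positivity)
    (inv_le_one_of_one_le₀ hsq) hz
  have h2 : Real.exp (-2) * (sphereUniform d).real (Metric.ball z (2 * (√w)⁻¹)) ≤
      sphereGauss d w z := by
    rw [mul_comm, ← smul_eq_mul, ← integral_indicator_const _ measurableSet_ball]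
    refine integral_mono ((integrable_const _).indicator measurableSet_ball)
      (integrable_gauss (by linarith) z) fun x => ?_
    by_cases hx : x ∈ Metric.ball z (2 * (√w)⁻¹)
    · rw [Set.indicator_of_mem hx]
      refine Real.exp_le_exp.2 ?_
      rw [Metric.mem_ball, dist_eq_norm] at hx
      have : ‖x - z‖ * √w ≤ 2 := by
        rw [← div_eq_mul_inv, lt_div_iff₀ hs0] at hx
        exact hx.le
      have h4 : (‖x - z‖ * √w) ^ 2 ≤ 2 ^ 2 := pow_le_pow_left₀ (by positivity) this 2
      rw [mul_pow, hww] at h4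
      linarith
    · rw [Set.indicator_of_notMem hx]
      positivity
  rw [inv_pow] at h1
  have hp : 0 < √w ^ (d - 1) := by positivity
  rw [inv_le_iff_one_le_mul₀ hp] at h1
  rw [div_le_iff₀ (by positivity)]
  have h3 := mul_le_mul_of_nonneg_right h2
    (mul_nonneg hp.le (by positivity : (0 : ℝ) ≤ d * 2 ^ d))
  calc Real.exp (-2) ≤ Real.exp (-2) * (d * 2 ^ d *
        (sphereUniform d).real (Metric.ball z (2 * (√w)⁻¹)) * √w ^ (d - 1)) :=
        le_mul_of_one_le_right (Real.exp_pos _).le h1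
    _ = _ := by ring
    _ ≤ _ := h3
    _ = _ := by ring

lemma lintegral_gauss {d : ℕ} {b : ℝ} (hb : 0 < b) (x : EuclideanSpace ℝ (Fin d)) :
    ∫⁻ y : EuclideanSpace ℝ (Fin d), ENNReal.ofReal (Real.exp (-b * ‖x - y‖ ^ 2)) =
      ENNReal.ofReal (√(π / b) ^ d) := by
  have hI := GaussianFourier.integral_rexp_neg_mul_sq_norm (V := EuclideanSpace ℝ (Fin d)) hb
  have hval : (π / b) ^ ((Module.finrank ℝ (EuclideanSpace ℝ (Fin d)) : ℝ) / 2) =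
      √(π / b) ^ d := by
    rw [finrank_euclideanSpace_fin, Real.sqrt_eq_rpow, ← Real.rpow_natCast,
      ← Real.rpow_mul (by positivity)]
    congr 1; ring
  rw [hval] at hI
  have hint : Integrable (fun v : EuclideanSpace ℝ (Fin d) => Real.exp (-b * ‖v‖ ^ 2)) := by
    by_contra hcon
    rw [integral_undef hcon] at hI
    have : 0 < √(π / b) ^ d := by positivity
    linarith
  have h1 := (lintegral_sub_left_eq_self (μ := (volume : Measure (EuclideanSpace ℝ (Fin d))))
    (fun y => ENNReal.ofReal (Real.exp (-b * ‖y‖ ^ 2))) x)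
  rw [h1, ← ofReal_integral_eq_lintegral_ofReal hint (.of_forall fun v => (Real.exp_pos _).le), hI]

/-- Upper bound for the Gaussian mean, of the optimal order. -/
lemma exists_sphereGauss_le {d : ℕ} (hd : 1 ≤ d) [IsProbabilityMeasure (sphereUniform d)] :
    ∃ K : ℝ, 0 < K ∧ ∀ w : ℝ, 1 ≤ w → ∀ z : EuclideanSpace ℝ (Fin d), ‖z‖ = 1 →
      sphereGauss d w z * √w ^ (d - 1) ≤ K := by
  have : Nonempty (Fin d) := ⟨⟨0, hd⟩⟩
  set V := volume (Metric.ball (0 : EuclideanSpace ℝ (Fin d)) 1) with hV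
  have hV0 : V ≠ 0 := (Metric.measure_ball_pos _ _ one_pos).ne'
  have hVt : V ≠ ⊤ := measure_ball_lt_top.ne
  have hVr : 0 < V.toReal := ENNReal.toReal_pos hV0 hVt
  refine ⟨√(4 * π) ^ d * Real.exp 1 / V.toReal, by positivity, fun w hw z hz => ?_⟩
  set s := (√w)⁻¹ with hs
  have hsq : 1 ≤ √w := Real.one_le_sqrt.2 hw
  have hsq0 : 0 < √w := by linarith
  have hww : √w ^ 2 = w := Real.sq_sqrt (by linarith)
  have hs0 : 0 < s := by positivity
  have hs1 : s ≤ 1 := inv_le_one_of_one_le₀ hsq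
  have hws : w * s ^ 2 = 1 := by
    rw [hs, inv_pow, hww, mul_inv_cancel₀ (by linarith)]
  set μ := sphereUniform d with hμ
  set γ := sphereGauss d w z with hγ
  have hγ0 : 0 ≤ γ := integral_nonneg fun x => (Real.exp_pos _).le
  set A : Set (EuclideanSpace ℝ (Fin d)) :=
    Metric.ball 0 (1 + s) \ Metric.closedBall 0 (1 - s) with hA
  have hAm : MeasurableSet A := measurableSet_ball.diff measurableSet_closedBall
  have h1 : ∫⁻ y : EuclideanSpace ℝ (Fin d), ∫⁻ x,
      ENNReal.ofReal (Real.exp (-(w / 4) * ‖x - y‖ ^ 2)) ∂μ =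
        ENNReal.ofReal (√(π / (w / 4)) ^ d) := by
    rw [lintegral_lintegral_swap (by fun_prop)]
    simp_rw [lintegral_gauss (by linarith : 0 < w / 4)]
    simp
  have h2 : ENNReal.ofReal (Real.exp (-1) * γ) * volume A ≤
      ∫⁻ y : EuclideanSpace ℝ (Fin d), ∫⁻ x,
        ENNReal.ofReal (Real.exp (-(w / 4) * ‖x - y‖ ^ 2)) ∂μ := by
    rw [← lintegral_indicator_const hAm]
    refine lintegral_mono fun y => ?_
    by_cases hy : y ∈ A
    swap
    · rw [Set.indicator_of_notMem hy]; exact zero_le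
    rw [Set.indicator_of_mem hy]
    simp only [hA, Set.mem_sdiff, Metric.mem_ball, Metric.mem_closedBall, dist_zero_right,
      not_le] at hy
    have hy0 : 0 < ‖y‖ := by linarith
    set u := ‖y‖⁻¹ • y with hu
    have hu1 : ‖u‖ = 1 := by
      rw [hu, norm_smul, norm_inv, norm_norm, inv_mul_cancel₀ hy0.ne']
    have huy : ‖u - y‖ ≤ s := by
      have : u - y = (1 - ‖y‖) • u := by
        rw [sub_smul, one_smul, hu, smul_smul, mul_inv_cancel₀ hy0.ne', one_smul]
      rw [this, norm_smul, hu1, mul_one, Real.norm_eq_abs, abs_le]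
      constructor <;> linarith
    rw [hγ, sphereGauss_eq w hz hu1, sphereGauss, ← integral_const_mul,
      ofReal_integral_eq_lintegral_ofReal ((integrable_gauss (by linarith) u).const_mul _)
        (.of_forall fun x => by positivity)]
    refine lintegral_mono fun x => ENNReal.ofReal_le_ofReal ?_
    rw [← Real.exp_add]
    refine Real.exp_le_exp.2 ?_
    have h3 : ‖x - y‖ ≤ ‖x - u‖ + s := by
      have := norm_sub_le_norm_sub_add_norm_sub x u y
      linarith
    have h4 : ‖x - y‖ ^ 2 ≤ 2 * ‖x - u‖ ^ 2 + 2 * s ^ 2 := by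
      nlinarith [norm_nonneg (x - y), sq_nonneg (‖x - u‖ - s)]
    nlinarith
  rw [h1, volume_shell hd hs0.le hs1, ← mul_assoc, ← hV, ← ENNReal.ofReal_toReal hVt,
    ← ENNReal.ofReal_mul (by positivity), ← ENNReal.ofReal_mul] at h2
  swap
  · have := pow_le_pow_left₀ (by linarith : 0 ≤ 1 - s) (by linarith : 1 - s ≤ 1 + s) d
    have : 0 ≤ (1 + s) ^ d - (1 - s) ^ d := by linarith
    positivity
  have h3 := (ENNReal.ofReal_le_ofReal_iff (by positivity)).1 h2
  have h4 : s ≤ (1 + s) ^ d - (1 - s) ^ d := by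
    have a1 : 1 + s ≤ (1 + s) ^ d := le_self_pow₀ (by linarith) (by omega)
    have a2 : (1 - s) ^ d ≤ 1 := pow_le_one₀ (by linarith) (by linarith)
    linarith
  have h5 : √(π / (w / 4)) ^ d = √(4 * π) ^ d * s ^ d := by
    rw [← mul_pow, hs, ← Real.sqrt_inv, ← Real.sqrt_mul (by positivity)]
    congr 2
    field_simp
  rw [h5] at h3
  have h6 : Real.exp (-1) * γ * s * V.toReal ≤ √(4 * π) ^ d * s ^ d := by
    refine le_trans ?_ h3
    gcongr
  have hsd : s ^ d = s * s ^ (d - 1) := by rw [← pow_succ', Nat.sub_add_cancel hd]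
  have h7 : Real.exp (-1) * γ * V.toReal ≤ √(4 * π) ^ d * s ^ (d - 1) := by
    rw [hsd] at h6
    refine le_of_mul_le_mul_left ?_ hs0
    linarith
  rw [le_div_iff₀ hVr]
  have h8 : s ^ (d - 1) * √w ^ (d - 1) = 1 := by
    rw [← mul_pow, hs, inv_mul_cancel₀ hsq0.ne', one_pow]
  have h9 : Real.exp 1 * Real.exp (-1) = 1 := by rw [← Real.exp_add]; simp
  calc γ * √w ^ (d - 1) * V.toReal
      = Real.exp 1 * √w ^ (d - 1) * (Real.exp (-1) * γ * V.toReal) := by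
        linear_combination (-(γ * √w ^ (d - 1) * V.toReal)) * h9
    _ ≤ Real.exp 1 * √w ^ (d - 1) * (√(4 * π) ^ d * s ^ (d - 1)) := by gcongr
    _ = √(4 * π) ^ d * Real.exp 1 := by
        linear_combination (√(4 * π) ^ d * Real.exp 1) * h8

/-- Halving the inverse bandwidth changes the Gaussian mean by at most a constant factor. -/
lemma exists_sphereGauss_half_le {d : ℕ} (hd : 1 ≤ d) [IsProbabilityMeasure (sphereUniform d)] :
    ∃ K : ℝ, 0 < K ∧ ∀ w : ℝ, 0 < w → ∀ z : EuclideanSpace ℝ (Fin d), ‖z‖ = 1 →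
      sphereGauss d (w / 2) z ≤ K * sphereGauss d w z := by
  obtain ⟨c, hc, hlow⟩ := exists_le_sphereGauss hd
  obtain ⟨K, hK, hup⟩ := exists_sphereGauss_le hd
  refine ⟨max (Real.exp 4) (K * √2 ^ (d - 1) / c), by positivity, fun w hw z hz => ?_⟩
  have hγ0 : 0 ≤ sphereGauss d w z := integral_nonneg fun x => (Real.exp_pos _).le
  rcases le_total w 2 with h2 | h2
  · calc sphereGauss d (w / 2) z ≤ 1 := sphereGauss_le_one (by linarith) z
      _ = Real.exp 4 * Real.exp (-4) := by rw [← Real.exp_add]; simp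
      _ ≤ Real.exp 4 * sphereGauss d w z := by
        refine mul_le_mul_of_nonneg_left ?_ (Real.exp_pos _).le
        exact (Real.exp_le_exp.2 (by linarith)).trans (exp_le_sphereGauss hw.le hz)
      _ ≤ _ := by gcongr; exact le_max_left _ _
  · have h3 := hlow w (by linarith) z hz
    have h4 := hup (w / 2) (by linarith) z hz
    have h5 : √w = √2 * √(w / 2) := by
      rw [← Real.sqrt_mul (by norm_num)]; congr 1; ring
    have hp : 0 < √(w / 2) ^ (d - 1) := by positivity
    refine le_trans ?_ (mul_le_mul_of_nonneg_right (le_max_right _ _) hγ0)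
    rw [h5, mul_pow] at h3
    rw [div_mul_eq_mul_div, le_div_iff₀ hc]
    refine le_of_mul_le_mul_right ?_ hp
    calc sphereGauss d (w / 2) z * c * √(w / 2) ^ (d - 1)
        = sphereGauss d (w / 2) z * √(w / 2) ^ (d - 1) * c := by ring
      _ ≤ K * (sphereGauss d w z * (√2 ^ (d - 1) * √(w / 2) ^ (d - 1))) := by gcongr
      _ = _ := by ring

/-- Second moment of an affine function of i.i.d. centred noises. -/
lemma integral_add_sum_mul_sq {n : ℕ} {ν : Measure ℝ} [IsProbabilityMeasure ν] {σ : ℝ}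
    (hsq : Integrable (fun t : ℝ => t ^ 2) ν) (hmean : (∫ t, t ∂ν) = 0)
    (hvar : (∫ t, t ^ 2 ∂ν) = σ ^ 2) (B : ℝ) (p : Fin n → ℝ) :
    ∫ e : Fin n → ℝ, (B + ∑ i, p i * e i) ^ 2 ∂(Measure.pi fun _ : Fin n => ν) =
      B ^ 2 + σ ^ 2 * ∑ i, p i ^ 2 := by
  have hid : MemLp (fun t : ℝ => t) 2 ν :=
    (memLp_two_iff_integrable_sq measurable_id.aestronglyMeasurable).2 hsq
  have hX : ∀ i, MemLp (fun t : ℝ => p i * t) 2 ν := fun i => hid.const_mul _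
  have hXi : ∀ i, MemLp (fun e : Fin n → ℝ => p i * e i) 2 (Measure.pi fun _ : Fin n => ν) :=
    fun i => (hX i).comp_measurePreserving (measurePreserving_eval (fun _ : Fin n => ν) i)
  have hS : MemLp (fun e : Fin n → ℝ => ∑ i, p i * e i) 2 (Measure.pi fun _ : Fin n => ν) :=
    memLp_finsetSum _ fun i _ => hXi i
  have hS0 : ∫ e : Fin n → ℝ, ∑ i, p i * e i ∂(Measure.pi fun _ : Fin n => ν) = 0 := by
    rw [integral_finsetSum _ fun i _ => (hXi i).integrable (by norm_num)]
    refine Finset.sum_eq_zero fun i _ => ?_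
    rw [integral_const_mul]
    have h2 := integral_comp_eval (μ := fun _ : Fin n => ν) (i := i) (f := fun t : ℝ => t)
      measurable_id.aestronglyMeasurable
    rw [h2, hmean, mul_zero]
  have hV := ProbabilityTheory.variance_sum_pi (μ := fun _ : Fin n => ν)
    (X := fun i t => p i * t) hX
  have hfun : (∑ i, fun e : Fin n → ℝ => p i * e i) = fun e : Fin n → ℝ => ∑ i, p i * e i := by
    ext e; simp
  rw [hfun, ProbabilityTheory.variance_eq_sub hS, hS0] at hV
  have hV1 : ∀ i, ProbabilityTheory.variance (fun t : ℝ => p i * t) ν = p i ^ 2 * σ ^ 2 := by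
    intro i
    rw [ProbabilityTheory.variance_const_mul, ProbabilityTheory.variance_eq_sub hid, hmean]
    simp [hvar]
  simp only [hV1, Pi.pow_apply] at hV
  have hexp : ∀ e : Fin n → ℝ, (B + ∑ i, p i * e i) ^ 2 =
      (B ^ 2 + 2 * B * ∑ i, p i * e i) + (∑ i, p i * e i) ^ 2 := fun e => by ring
  simp_rw [hexp]
  have hSi : Integrable (fun e : Fin n → ℝ => 2 * B * ∑ i, p i * e i)
      (Measure.pi fun _ : Fin n => ν) := (hS.integrable (by norm_num)).const_mul _
  have hBS : Integrable (fun e : Fin n → ℝ => B ^ 2 + 2 * B * ∑ i, p i * e i)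
      (Measure.pi fun _ : Fin n => ν) := (integrable_const _).add hSi
  rw [integral_add hBS hS.integrable_sq, integral_add (integrable_const _) hSi,
    integral_const_mul, hS0]
  rw [← Finset.sum_mul] at hV
  simp only [integral_const, probReal_univ, one_smul]
  linarith

lemma quadForm_smul_one {d : ℕ} (w : ℝ) {x z : EuclideanSpace ℝ (Fin d)}
    (hx : ‖x‖ = 1) (hz : ‖z‖ = 1) :
    quadForm (w • (1 : Matrix (Fin d) (Fin d) ℝ)) x z = w + -w * ‖x - z‖ ^ 2 / 2 := by
  have h1 : quadForm (w • (1 : Matrix (Fin d) (Fin d) ℝ)) x z = w * inner ℝ x z := by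
    simp only [quadForm, Matrix.smul_apply, Matrix.one_apply, smul_eq_mul, mul_ite, mul_one,
      mul_zero, ite_mul, zero_mul, Finset.sum_ite_eq, Finset.mem_univ, if_true]
    rw [PiLp.inner_apply, Finset.mul_sum]
    refine Finset.sum_congr rfl fun i _ => ?_
    simp only [RCLike.inner_apply, conj_trivial]
    ring
  rw [h1, norm_sub_sq_real, hx, hz]
  ring

lemma softmaxPred_smul_one {d n : ℕ} (w : ℝ) {x : Fin (n + 1) → EuclideanSpace ℝ (Fin d)}
    (hx : ∀ i, ‖x i‖ = 1) (y : Fin n → ℝ) :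
    softmaxPred (w • (1 : Matrix (Fin d) (Fin d) ℝ)) x y =
      (∑ i : Fin n, y i * Real.exp (-w * ‖x i.castSucc - x (Fin.last n)‖ ^ 2 / 2)) /
        ∑ i : Fin n, Real.exp (-w * ‖x i.castSucc - x (Fin.last n)‖ ^ 2 / 2) := by
  unfold softmaxPred
  simp_rw [quadForm_smul_one w (hx _) (hx _), Real.exp_add]
  simp_rw [mul_left_comm _ (Real.exp w)]
  rw [← Finset.mul_sum, ← Finset.mul_sum, mul_div_mul_left _ _ (Real.exp_pos w).ne']

/-- Squared bias plus variance of a normalized weighted average. The summands with the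
exponential factor are relevant only if the total weight is smaller than the threshold `m`. -/
lemma weighted_bias_variance_le {ι : Type*} [Fintype ι] [Nonempty ι] {g t δ : ι → ℝ}
    {L σ m : ℝ} (hm : 0 < m) (hg : ∀ i, 0 < g i) (hg1 : ∀ i, g i ≤ 1) (ht : ∀ i, 0 ≤ t i)
    (ht2 : ∀ i, t i ≤ 2) (hδ : ∀ i, |δ i| ≤ L * t i) :
    (∑ i, g i / (∑ j, g j) * δ i) ^ 2 + σ ^ 2 * ∑ i, (g i / ∑ j, g j) ^ 2 ≤
      L ^ 2 * ((∑ i, t i ^ 2 * g i) / m + 4 * Real.exp (m - ∑ j, g j)) +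
        σ ^ 2 * (1 / m + Real.exp (m - ∑ j, g j)) := by
  set D := ∑ j, g j with hD
  have hD0 : 0 < D := Finset.sum_pos (fun i _ => hg i) Finset.univ_nonempty
  have hp0 : ∀ i, 0 ≤ g i / D := fun i => (div_pos (hg i) hD0).le
  have hp1 : ∑ i, g i / D = 1 := by rw [← Finset.sum_div, div_self hD0.ne']
  have hbias : (∑ i, g i / D * δ i) ^ 2 ≤ ∑ i, g i / D * δ i ^ 2 :=
    Real.pow_arith_mean_le_arith_mean_pow_of_even _ _ _ (fun i _ => hp0 i) hp1 even_two
  have hδ2 : ∀ i, δ i ^ 2 ≤ L ^ 2 * t i ^ 2 := fun i => by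
    rw [← mul_pow, ← sq_abs (δ i)]
    exact pow_le_pow_left₀ (abs_nonneg _) (hδ i) 2
  have hbias2 : (∑ i, g i / D * δ i) ^ 2 ≤ L ^ 2 * ((∑ i, t i ^ 2 * g i) / D) := by
    refine hbias.trans ?_
    rw [Finset.sum_div, Finset.mul_sum]
    refine Finset.sum_le_sum fun i _ => ?_
    calc g i / D * δ i ^ 2 ≤ g i / D * (L ^ 2 * t i ^ 2) :=
          mul_le_mul_of_nonneg_left (hδ2 i) (hp0 i)
      _ = _ := by ring
  have hT4 : (∑ i, t i ^ 2 * g i) / D ≤ 4 := by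
    rw [div_le_iff₀ hD0, hD, Finset.mul_sum]
    refine Finset.sum_le_sum fun i _ => mul_le_mul_of_nonneg_right ?_ (hg i).le
    nlinarith [ht i, ht2 i]
  have hsq : ∑ i, (g i / D) ^ 2 ≤ 1 / D := by
    calc ∑ i, (g i / D) ^ 2 ≤ ∑ i, g i / D * (1 / D) := by
          refine Finset.sum_le_sum fun i _ => ?_
          rw [sq]
          refine mul_le_mul_of_nonneg_left ?_ (hp0 i)
          exact div_le_div_of_nonneg_right (hg1 i) hD0.le
      _ = 1 / D := by rw [← Finset.sum_mul, hp1, one_mul]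
  have hsq1 : ∑ i, (g i / D) ^ 2 ≤ 1 := by
    rw [← hp1]
    refine Finset.sum_le_sum fun i _ => ?_
    rw [sq]
    refine mul_le_of_le_one_right (hp0 i) ?_
    rw [div_le_one hD0]
    exact Finset.single_le_sum (fun j _ => (hg j).le) (Finset.mem_univ i)
  have hN0 : 0 ≤ ∑ i, t i ^ 2 * g i :=
    Finset.sum_nonneg fun i _ => mul_nonneg (sq_nonneg _) (hg i).le
  have he := Real.exp_pos (m - D)
  have hkey : (∑ i, t i ^ 2 * g i) / D ≤ (∑ i, t i ^ 2 * g i) / m + 4 * Real.exp (m - D) ∧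
      ∑ i, (g i / D) ^ 2 ≤ 1 / m + Real.exp (m - D) := by
    rcases le_total m D with h | h
    · have h1 : (∑ i, t i ^ 2 * g i) / D ≤ (∑ i, t i ^ 2 * g i) / m := by gcongr
      have h2 : 1 / D ≤ 1 / m := by gcongr
      constructor <;> linarith
    · have h1 : 1 ≤ Real.exp (m - D) := Real.one_le_exp (by linarith)
      have h2 : 0 ≤ (∑ i, t i ^ 2 * g i) / m := by positivity
      have h3 : 0 ≤ 1 / m := by positivity
      constructor <;> linarith
  exact add_le_add (hbias2.trans (mul_le_mul_of_nonneg_left hkey.1 (sq_nonneg L)))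
    (mul_le_mul_of_nonneg_left hkey.2 (sq_nonneg σ))

/-- Conditionally on covariates in the sphere, the loss is at most a smooth functional of the
Gaussian weights. -/
lemma integral_softmaxPred_sub_sq_le {d n : ℕ} [NeZero n] {ν : Measure ℝ}
    [IsProbabilityMeasure ν] {L σ w m : ℝ} (hw : 0 ≤ w) (hm : 0 < m)
    (hsq : Integrable (fun t : ℝ => t ^ 2) ν) (hmean : (∫ t, t ∂ν) = 0)
    (hvar : (∫ t, t ^ 2 ∂ν) = σ ^ 2) {f : EuclideanSpace ℝ (Fin d) → ℝ}
    (hf : ∀ x y : EuclideanSpace ℝ (Fin d), ‖x‖ = 1 → ‖y‖ = 1 → |f x - f y| ≤ L * ‖x - y‖)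
    {x : Fin (n + 1) → EuclideanSpace ℝ (Fin d)} (hx : ∀ i, ‖x i‖ = 1) :
    ∫ e : Fin n → ℝ, (softmaxPred (w • (1 : Matrix (Fin d) (Fin d) ℝ)) x
        (fun i => f (x i.castSucc) + e i) - f (x (Fin.last n))) ^ 2
          ∂(Measure.pi fun _ : Fin n => ν) ≤
      L ^ 2 * ((∑ i : Fin n, ‖x i.castSucc - x (Fin.last n)‖ ^ 2 *
          Real.exp (-w * ‖x i.castSucc - x (Fin.last n)‖ ^ 2 / 2)) / m +
        4 * Real.exp (m - ∑ i : Fin n,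
          Real.exp (-w * ‖x i.castSucc - x (Fin.last n)‖ ^ 2 / 2))) +
      σ ^ 2 * (1 / m + Real.exp (m - ∑ i : Fin n,
        Real.exp (-w * ‖x i.castSucc - x (Fin.last n)‖ ^ 2 / 2))) := by
  set z := x (Fin.last n) with hz
  set g : Fin n → ℝ := fun i => Real.exp (-w * ‖x i.castSucc - z‖ ^ 2 / 2) with hg
  set D := ∑ j, g j with hD
  have hD0 : 0 < D := Finset.sum_pos (fun i _ => Real.exp_pos _) Finset.univ_nonempty
  have hp1 : ∑ i, g i / D = 1 := by rw [← Finset.sum_div, div_self hD0.ne']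
  have hsplit : ∀ e : Fin n → ℝ, softmaxPred (w • (1 : Matrix (Fin d) (Fin d) ℝ)) x
      (fun i => f (x i.castSucc) + e i) - f z =
        (∑ i, g i / D * (f (x i.castSucc) - f z)) + ∑ i, g i / D * e i := by
    intro e
    rw [softmaxPred_smul_one w hx, ← Finset.sum_add_distrib]
    calc (∑ i, (f (x i.castSucc) + e i) * g i) / D - f z
        = ∑ i, g i / D * (f (x i.castSucc) + e i) - (∑ i, g i / D) * f z := by
          rw [hp1, one_mul, Finset.sum_div]
          congr 1
          exact Finset.sum_congr rfl fun i _ => by ring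
      _ = _ := by
          rw [Finset.sum_mul, ← Finset.sum_sub_distrib]
          exact Finset.sum_congr rfl fun i _ => by ring
  simp_rw [hsplit]
  rw [integral_add_sum_mul_sq hsq hmean hvar]
  refine weighted_bias_variance_le hm (fun i => Real.exp_pos _) (fun i => ?_)
    (fun i => norm_nonneg _) (fun i => ?_) fun i => hf _ _ (hx _) (hx _)
  · rw [Real.exp_le_one_iff]
    nlinarith [mul_nonneg hw (sq_nonneg ‖x i.castSucc - z‖)]
  · have := norm_sub_le (x i.castSucc) z
    rw [hx, hz, hx] at this
    linarith

lemma sq_mul_gauss_le {w : ℝ} (hw : 0 < w) (t : ℝ) :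
    t ^ 2 * Real.exp (-w * t ^ 2 / 2) ≤ 4 / w * Real.exp (-(w / 2) * t ^ 2 / 2) := by
  have h1 : w * t ^ 2 / 4 ≤ Real.exp (w * t ^ 2 / 4) := by
    linarith [Real.add_one_le_exp (w * t ^ 2 / 4)]
  have h2 : Real.exp (-(w / 2) * t ^ 2 / 2) =
      Real.exp (w * t ^ 2 / 4) * Real.exp (-w * t ^ 2 / 2) := by
    rw [← Real.exp_add]; congr 1; ring
  rw [h2, ← mul_assoc]
  refine mul_le_mul_of_nonneg_right ?_ (Real.exp_pos _).le
  rw [div_mul_eq_mul_div, le_div_iff₀ hw]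
  linarith

lemma sq_mul_gauss_le_const {w : ℝ} (hw : 0 < w) (t : ℝ) :
    t ^ 2 * Real.exp (-w * t ^ 2 / 2) ≤ 4 / w := by
  refine (sq_mul_gauss_le hw t).trans (mul_le_of_le_one_right (by positivity) ?_)
  rw [Real.exp_le_one_iff]
  nlinarith [mul_nonneg hw.le (sq_nonneg t)]

lemma exp_neg_le_one_sub_half {g : ℝ} (h0 : 0 ≤ g) (h1 : g ≤ 1) :
    Real.exp (-g) ≤ 1 - g / 2 := by
  rw [Real.exp_neg, inv_le_iff_one_le_mul₀ (Real.exp_pos g)]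
  have := Real.add_one_le_exp g
  nlinarith

/-- Laplace transform of the total Gaussian weight of `n` uniform points on the sphere. -/
lemma integral_exp_neg_sum_gauss_le {d : ℕ} (n : ℕ) [IsProbabilityMeasure (sphereUniform d)]
    {w : ℝ} (hw : 0 ≤ w) (z : EuclideanSpace ℝ (Fin d)) :
    ∫ y : Fin n → EuclideanSpace ℝ (Fin d),
        Real.exp (-∑ i, Real.exp (-w * ‖y i - z‖ ^ 2 / 2))
          ∂(Measure.pi fun _ : Fin n => sphereUniform d) ≤
      Real.exp (-(n * sphereGauss d w z / 2)) := by
  simp_rw [← Finset.sum_neg_distrib, Real.exp_sum]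
  rw [integral_fintype_prod_eq_prod
    (f := fun (_ : Fin n) (x : EuclideanSpace ℝ (Fin d)) =>
      Real.exp (-Real.exp (-w * ‖x - z‖ ^ 2 / 2))), Finset.prod_const, Finset.card_univ,
    Fintype.card_fin]
  have h1 : ∫ x, Real.exp (-Real.exp (-w * ‖x - z‖ ^ 2 / 2)) ∂sphereUniform d ≤
      Real.exp (-(sphereGauss d w z / 2)) := by
    calc ∫ x, Real.exp (-Real.exp (-w * ‖x - z‖ ^ 2 / 2)) ∂sphereUniform d
        ≤ ∫ x, (1 - Real.exp (-w * ‖x - z‖ ^ 2 / 2) / 2) ∂sphereUniform d := by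
          refine integral_mono_of_nonneg (.of_forall fun x => (Real.exp_pos _).le)
            ((integrable_const _).sub ((integrable_gauss hw z).div_const 2))
            (.of_forall fun x => exp_neg_le_one_sub_half (Real.exp_pos _).le ?_)
          rw [Real.exp_le_one_iff]
          nlinarith [mul_nonneg hw (sq_nonneg ‖x - z‖)]
      _ = 1 - sphereGauss d w z / 2 := by
          rw [integral_sub (integrable_const _) ((integrable_gauss hw z).div_const 2),
            integral_div]
          simp [sphereGauss]
      _ ≤ _ := by linarith [Real.add_one_le_exp (-(sphereGauss d w z / 2))]
  refine (pow_le_pow_left₀ (integral_nonneg fun x => (Real.exp_pos _).le) h1 n).trans_eq ?_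
  rw [← Real.exp_nat_mul]
  congr 1; ring

lemma integral_sum_sq_mul_gauss_le {d : ℕ} (n : ℕ) [IsProbabilityMeasure (sphereUniform d)]
    {w : ℝ} (hw : 0 < w) (z : EuclideanSpace ℝ (Fin d)) :
    ∫ y : Fin n → EuclideanSpace ℝ (Fin d),
        ∑ i, ‖y i - z‖ ^ 2 * Real.exp (-w * ‖y i - z‖ ^ 2 / 2)
          ∂(Measure.pi fun _ : Fin n => sphereUniform d) ≤
      n * (4 / w * sphereGauss d (w / 2) z) := by
  have hb : ∀ x : EuclideanSpace ℝ (Fin d),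
      ‖‖x - z‖ ^ 2 * Real.exp (-w * ‖x - z‖ ^ 2 / 2)‖ ≤ 4 / w := fun x => by
    rw [Real.norm_eq_abs, abs_of_nonneg (by positivity)]
    exact sq_mul_gauss_le_const hw _
  rw [integral_finsetSum _ fun i _ =>
    Integrable.of_bound (C := 4 / w) (by fun_prop) (.of_forall fun y => hb (y i))]
  have h1 : ∀ i : Fin n, ∫ y : Fin n → EuclideanSpace ℝ (Fin d),
      ‖y i - z‖ ^ 2 * Real.exp (-w * ‖y i - z‖ ^ 2 / 2)
        ∂(Measure.pi fun _ : Fin n => sphereUniform d) ≤ 4 / w * sphereGauss d (w / 2) z := by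
    intro i
    rw [integral_comp_eval (μ := fun _ : Fin n => sphereUniform d) (i := i)
      (f := fun x => ‖x - z‖ ^ 2 * Real.exp (-w * ‖x - z‖ ^ 2 / 2)) (by fun_prop),
      sphereGauss, ← integral_const_mul]
    exact integral_mono_of_nonneg (.of_forall fun x => by positivity)
      ((integrable_gauss (by positivity) z).const_mul _)
      (.of_forall fun x => sq_mul_gauss_le hw _)
  refine (Finset.sum_le_sum fun i _ => h1 i).trans_eq ?_
  simp

/-- Risk bound in terms of the Gaussian means on the sphere. -/
lemma testLoss_le_of_sphereGauss {d n : ℕ} [NeZero n] [IsProbabilityMeasure (sphereUniform d)]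
    {ν : Measure ℝ} [IsProbabilityMeasure ν] {L σ w K γ : ℝ} (hw : 0 < w) (hγ : 0 < γ)
    (hsq : Integrable (fun t : ℝ => t ^ 2) ν) (hmean : (∫ t, t ∂ν) = 0)
    (hvar : (∫ t, t ^ 2 ∂ν) = σ ^ 2) {f : EuclideanSpace ℝ (Fin d) → ℝ}
    (hf : ∀ x y : EuclideanSpace ℝ (Fin d), ‖x‖ = 1 → ‖y‖ = 1 → |f x - f y| ≤ L * ‖x - y‖)
    (hGγ : ∀ z : EuclideanSpace ℝ (Fin d), ‖z‖ = 1 → sphereGauss d w z = γ)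
    (hGK : ∀ z : EuclideanSpace ℝ (Fin d), ‖z‖ = 1 → sphereGauss d (w / 2) z ≤ K * γ) :
    testLoss d n ν f (w • (1 : Matrix (Fin d) (Fin d) ℝ)) ≤
      L ^ 2 * (16 * K / w + 4 * Real.exp (-(n * γ / 4))) +
        σ ^ 2 * (4 / (n * γ) + Real.exp (-(n * γ / 4))) := by
  set μ := sphereUniform d with hμ
  have hn : (0 : ℝ) < n := by exact_mod_cast Nat.pos_of_ne_zero (NeZero.ne n)
  set m : ℝ := n * γ / 4 with hm
  have hm0 : 0 < m := by positivity
  set N : EuclideanSpace ℝ (Fin d) × (Fin n → EuclideanSpace ℝ (Fin d)) → ℝ := fun q =>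
    ∑ i, ‖q.2 i - q.1‖ ^ 2 * Real.exp (-w * ‖q.2 i - q.1‖ ^ 2 / 2) with hN
  set D : EuclideanSpace ℝ (Fin d) × (Fin n → EuclideanSpace ℝ (Fin d)) → ℝ := fun q =>
    ∑ i, Real.exp (-w * ‖q.2 i - q.1‖ ^ 2 / 2) with hD
  set Φ : EuclideanSpace ℝ (Fin d) × (Fin n → EuclideanSpace ℝ (Fin d)) → ℝ := fun q =>
    L ^ 2 * (N q / m + 4 * Real.exp (m - D q)) + σ ^ 2 * (1 / m + Real.exp (m - D q)) with hΦ
  have hNm : Measurable N := by fun_prop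
  have hDm : Measurable D := by fun_prop
  have hN0 : ∀ q, 0 ≤ N q := fun q => Finset.sum_nonneg fun i _ => by positivity
  have hNb : ∀ q, ‖N q‖ ≤ n * (4 / w) := fun q => by
    rw [Real.norm_eq_abs, abs_of_nonneg (hN0 q)]
    refine (Finset.sum_le_sum fun i _ => sq_mul_gauss_le_const hw _).trans_eq ?_
    simp
  have hD0 : ∀ q, 0 ≤ D q := fun q => Finset.sum_nonneg fun i _ => (Real.exp_pos _).le
  have hEb : ∀ q, ‖Real.exp (-D q)‖ ≤ 1 := fun q => by
    rw [Real.norm_eq_abs, abs_of_pos (Real.exp_pos _), Real.exp_le_one_iff]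
    linarith [hD0 q]
  have hΦeq : Φ = fun q => (L ^ 2 / m) * N q +
      ((4 * L ^ 2 + σ ^ 2) * Real.exp m) * Real.exp (-D q) + σ ^ 2 / m := by
    ext q
    simp only [hΦ, sub_eq_add_neg, Real.exp_add]
    ring
  have hΦi : Integrable Φ (μ.prod (Measure.pi fun _ : Fin n => μ)) := by
    rw [hΦeq]
    refine Integrable.add (Integrable.add ?_ ?_) (integrable_const _)
    · exact (Integrable.of_bound hNm.aestronglyMeasurable _ (.of_forall hNb)).const_mul _
    · exact (Integrable.of_bound hDm.neg.exp.aestronglyMeasurable _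
        (.of_forall hEb)).const_mul _
  have hmp := measurePreserving_piFinSuccAbove (fun _ : Fin (n + 1) => μ) (Fin.last n)
  have hae : ∀ᵐ x ∂(Measure.pi fun _ : Fin (n + 1) => μ), ∀ i, ‖x i‖ = 1 := by
    rw [ae_all_iff]
    exact fun i => (measurePreserving_eval (fun _ : Fin (n + 1) => μ) i).quasiMeasurePreserving.ae
      (ae_norm_eq_one_sphereUniform d)
  have hfirst : testLoss d n ν f (w • (1 : Matrix (Fin d) (Fin d) ℝ)) ≤
      ∫ x, Φ (MeasurableEquiv.piFinSuccAbove (fun _ => EuclideanSpace ℝ (Fin d)) (Fin.last n) x)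
        ∂(Measure.pi fun _ : Fin (n + 1) => μ) := by
    refine integral_mono_of_nonneg (.of_forall fun x => integral_nonneg fun e => sq_nonneg _)
      (hmp.integrable_comp_of_integrable hΦi) ?_
    filter_upwards [hae] with x hx
    refine (integral_softmaxPred_sub_sq_le hw.le hm0 hsq hmean hvar hf hx).trans_eq ?_
    simp [hΦ, hN, hD, MeasurableEquiv.piFinSuccAbove, Fin.init, Fin.insertNthEquiv]
  refine hfirst.trans ?_
  rw [hmp.integral_comp' Φ, integral_prod _ hΦi]
  have hbound : ∀ z : EuclideanSpace ℝ (Fin d), ‖z‖ = 1 →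
      ∫ y, Φ (z, y) ∂(Measure.pi fun _ : Fin n => μ) ≤
        L ^ 2 * (16 * K / w + 4 * Real.exp (-m)) +
          σ ^ 2 * (4 / (n * γ) + Real.exp (-m)) := by
    intro z hz
    have hi1 : Integrable (fun y => (L ^ 2 / m) * N (z, y)) (Measure.pi fun _ : Fin n => μ) :=
      (Integrable.of_bound (hNm.comp measurable_prodMk_left).aestronglyMeasurable _
        (.of_forall fun y => hNb (z, y))).const_mul _
    have hi2 : Integrable (fun y => ((4 * L ^ 2 + σ ^ 2) * Real.exp m) * Real.exp (-D (z, y)))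
        (Measure.pi fun _ : Fin n => μ) :=
      (Integrable.of_bound (hDm.comp measurable_prodMk_left).neg.exp.aestronglyMeasurable _
        (.of_forall fun y => hEb (z, y))).const_mul _
    rw [hΦeq]
    have hi12 : Integrable (fun y => (L ^ 2 / m) * N (z, y) +
      ((4 * L ^ 2 + σ ^ 2) * Real.exp m) * Real.exp (-D (z, y)))
        (Measure.pi fun _ : Fin n => μ) := hi1.add hi2
    rw [integral_add hi12 (integrable_const _), integral_add hi1 hi2,
      integral_const_mul, integral_const_mul]
    have hA : ∫ y, N (z, y) ∂(Measure.pi fun _ : Fin n => μ) ≤ n * (4 / w * (K * γ)) :=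
      (integral_sum_sq_mul_gauss_le n hw z).trans (by gcongr; exact hGK z hz)
    have hB : ∫ y, Real.exp (-D (z, y)) ∂(Measure.pi fun _ : Fin n => μ) ≤
        Real.exp (-(n * γ / 2)) := by
      have := integral_exp_neg_sum_gauss_le n hw.le z
      rwa [hGγ z hz] at this
    have hexp : Real.exp m * Real.exp (-(n * γ / 2)) = Real.exp (-m) := by
      rw [← Real.exp_add]; congr 1; rw [hm]; ring
    simp only [integral_const, probReal_univ, one_smul]
    calc L ^ 2 / m * ∫ y, N (z, y) ∂(Measure.pi fun _ : Fin n => μ) +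
          (4 * L ^ 2 + σ ^ 2) * Real.exp m *
            ∫ y, Real.exp (-D (z, y)) ∂(Measure.pi fun _ : Fin n => μ) + σ ^ 2 / m
        ≤ L ^ 2 / m * (n * (4 / w * (K * γ))) +
          (4 * L ^ 2 + σ ^ 2) * Real.exp m * Real.exp (-(n * γ / 2)) + σ ^ 2 / m := by
          gcongr
      _ = _ := by
          rw [mul_assoc _ (Real.exp m), hexp, hm]
          field_simp
          ring
  calc ∫ z, ∫ y, Φ (z, y) ∂(Measure.pi fun _ : Fin n => μ) ∂μ
      ≤ ∫ _, L ^ 2 * (16 * K / w + 4 * Real.exp (-m)) +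
          σ ^ 2 * (4 / (n * γ) + Real.exp (-m)) ∂μ := by
        refine integral_mono_ae hΦi.integral_prod_left (integrable_const _) ?_
        filter_upwards [ae_norm_eq_one_sphereUniform d] with z hz using hbound z hz
    _ = _ := by simp

/-- Theorem 5 (upper bound): learning the Lipschitzness suffices for generalization.
For `w` in the range attained by pretraining (`a Λ^{1/(d+2)} ≤ w ≤ b Λ^{2/(d+2)}`),
the ICL test loss of `w • I_d` on any `L`-Lipschitz task is at most `C L² Λ^{-1/(d+2)}`. -/
theorem lipschitz_generalization_upper_bound (d : ℕ) (hd : 2 ≤ d) :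
    ∃ N0 : ℝ, 0 < N0 ∧
      ∀ a b : ℝ, 0 < a → a ≤ b →
        ∃ C : ℝ, 0 < C ∧
          ∀ (n : ℕ) (L σ : ℝ) (ν : Measure ℝ),
            0 < L → 0 < σ →
            IsProbabilityMeasure ν →
            Integrable (fun t : ℝ => t ^ 2) ν →
            (∫ t, t ∂ν) = 0 →
            (∫ t, t ^ 2 ∂ν) = σ ^ 2 →
            N0 * (1 + (L * Real.log n / σ) ^ d) ≤ (n : ℝ) →
            ∀ w : ℝ,
              a * ((n : ℝ) * L ^ 2 / σ ^ 2) ^ ((1 : ℝ) / ((d : ℝ) + 2)) ≤ w →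
              w ≤ b * ((n : ℝ) * L ^ 2 / σ ^ 2) ^ ((2 : ℝ) / ((d : ℝ) + 2)) →
              45 * Real.sqrt d * w ^ ((d : ℝ) / 2) ≤ (n : ℝ) / Real.log n →
              ∀ f : EuclideanSpace ℝ (Fin d) → ℝ, Measurable f →
                (∀ x y : EuclideanSpace ℝ (Fin d), ‖x‖ = 1 → ‖y‖ = 1 →
                  |f x - f y| ≤ L * ‖x - y‖) →
                testLoss d n ν f (w • (1 : Matrix (Fin d) (Fin d) ℝ)) ≤
                  C * L ^ 2 * ((n : ℝ) * L ^ 2 / σ ^ 2) ^ (-(1 : ℝ) / ((d : ℝ) + 2)) := by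
  rcases sphereUniform_eq_zero_or_isProbabilityMeasure d with h0 | hprob
  · refine ⟨1, one_pos, fun a b ha hab => ⟨1, one_pos, ?_⟩⟩
    intro n L σ ν hL hσ hν hsq hmean hvar hn w hw1 hw2 hw3 f hfm hf
    have : testLoss d n ν f (w • (1 : Matrix (Fin d) (Fin d) ℝ)) = 0 := by
      have hpi : (Measure.pi fun _ : Fin (n + 1) => sphereUniform d) = 0 := by
        rw [h0, ← Measure.measure_univ_eq_zero, Measure.pi_univ]
        simp
      rw [testLoss, hpi, integral_zero_measure]
    rw [this]
    positivity
  obtain ⟨c, hc, hlow⟩ := exists_le_sphereGauss (d := d) (by omega)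
  obtain ⟨K, hK, hhalf⟩ := exists_sphereGauss_half_le (d := d) (by omega)
  refine ⟨3, by norm_num, fun a b ha hab => ?_⟩
  have hb : 0 < b := ha.trans_le hab
  set B := b / a + b + 1 with hB
  have hB0 : 0 < B := by positivity
  refine ⟨16 * K / a + 128 / (c ^ 2 * a) + 8 * B ^ (d + 1) / c, by positivity, ?_⟩
  intro n L σ ν hL hσ hν hsq hmean hvar hn w hw1 hw2 hw3 f hfm hf
  have hlog0 : 0 ≤ Real.log n := Real.log_natCast_nonneg n
  have hn3 : (3 : ℝ) ≤ n := by
    have : 0 ≤ (L * Real.log n / σ) ^ d := by positivity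
    linarith
  have hn0 : (0 : ℝ) < n := by linarith
  have : NeZero n := ⟨by rintro rfl; simp at hn0⟩
  have hlog : 1 ≤ Real.log n := by
    rw [Real.le_log_iff_exp_le hn0]
    linarith [Real.exp_one_lt_d9]
  set Λ : ℝ := (n : ℝ) * L ^ 2 / σ ^ 2 with hΛ
  have hΛ0 : 0 < Λ := by positivity
  set τ : ℝ := Λ ^ ((1 : ℝ) / ((d : ℝ) + 2)) with hτ
  have hτ0 : 0 < τ := by positivity
  have hd2 : (d : ℝ) + 2 ≠ 0 := by positivity
  have hτ2 : Λ ^ ((2 : ℝ) / ((d : ℝ) + 2)) = τ ^ 2 := by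
    rw [hτ, ← Real.rpow_natCast, ← Real.rpow_mul hΛ0.le]
    congr 1; push_cast; ring
  have hτΛ : τ ^ (d + 2) = Λ := by
    rw [hτ, ← Real.rpow_natCast, ← Real.rpow_mul hΛ0.le]
    push_cast
    rw [one_div_mul_cancel hd2, Real.rpow_one]
  have hτinv : Λ ^ (-(1 : ℝ) / ((d : ℝ) + 2)) = τ⁻¹ := by
    rw [neg_div, Real.rpow_neg hΛ0.le]
  rw [hτ2] at hw2
  rw [hτinv]
  have hw0 : 0 < w := (mul_pos ha hτ0).trans_le hw1
  have hτB : 1 ≤ b / a * τ := by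
    rw [div_mul_eq_mul_div, le_div_iff₀ ha]
    have : a * τ ≤ (b * τ) * τ := by linarith
    have := le_of_mul_le_mul_right this hτ0
    linarith
  set W := max 1 w with hW
  have hW1 : 1 ≤ W := le_max_left _ _
  set R := √W with hR
  have hR0 : 0 < R := Real.sqrt_pos.2 (by linarith)
  have hR2 : R ^ 2 = W := Real.sq_sqrt (by linarith)
  have hba : 0 < b / a := by positivity
  have hRτ : R ≤ B * τ := by
    refine Real.sqrt_le_iff.2 ⟨by positivity, max_le ?_ ?_⟩
    · refine one_le_pow₀ (hτB.trans (mul_le_mul_of_nonneg_right ?_ hτ0.le))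
      linarith
    · rw [mul_pow]
      refine hw2.trans (mul_le_mul_of_nonneg_right ?_ (sq_nonneg τ))
      nlinarith
  have hnw : √w ^ d ≤ n := by
    have h1 : w ^ ((d : ℝ) / 2) = √w ^ d := by
      rw [Real.sqrt_eq_rpow, ← Real.rpow_natCast, ← Real.rpow_mul hw0.le]
      congr 1; ring
    rw [h1] at hw3
    have h2 : (1 : ℝ) ≤ √d := Real.one_le_sqrt.2 (by exact_mod_cast (by omega : 1 ≤ d))
    have h3 : 0 ≤ √w ^ d := by positivity
    have h4 : (n : ℝ) / Real.log n ≤ n := div_le_self hn0.le hlog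
    nlinarith [mul_le_mul_of_nonneg_right h2 h3]
  have hnR : R ^ d ≤ n := by
    rcases le_total w 1 with h | h
    · rw [hR, hW, max_eq_left h, Real.sqrt_one, one_pow]; linarith
    · rwa [hR, hW, max_eq_right h]
  have hdim : 0 < d := by omega
  set z : EuclideanSpace ℝ (Fin d) := EuclideanSpace.single ⟨0, hdim⟩ 1 with hz
  have hz1 : ‖z‖ = 1 := by simp [hz]
  set γ := sphereGauss d w z with hγ
  have hγR : c ≤ γ * R ^ (d - 1) := (hlow W hW1 z hz1).trans
    (mul_le_mul_of_nonneg_right (sphereGauss_anti hw0.le (le_max_right _ _) z) (by positivity))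
  have hγ0 : 0 < γ := pos_of_mul_pos_left (hc.trans_le hγR) (by positivity)
  have hRd : R ^ d = R * R ^ (d - 1) := by rw [← pow_succ', Nat.sub_add_cancel hdim]
  have hnγ : c * R ≤ n * γ := by
    have hp : 0 < R ^ (d - 1) := by positivity
    refine le_of_mul_le_mul_right ?_ hp
    calc c * R * R ^ (d - 1) = c * R ^ d := by rw [hRd]; ring
      _ ≤ (γ * R ^ (d - 1)) * n := by gcongr
      _ = _ := by ring
  have hmain := testLoss_le_of_sphereGauss (n := n) (L := L) (σ := σ) (K := K) hw0 hγ0 hsq hmean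
    hvar hf (fun z' hz' => sphereGauss_eq w hz' hz1)
    (fun z' hz' => (hhalf w hw0 z' hz').trans_eq (by rw [sphereGauss_eq w hz' hz1]))
  refine hmain.trans ?_
  set u := (n : ℝ) * γ with hu
  have hu0 : 0 < u := by positivity
  have haτ : 0 < a * τ := by positivity
  have e1 : 16 * K / w ≤ 16 * K / a * τ⁻¹ := by
    rw [← div_eq_mul_inv, div_div]
    gcongr
  have e2 : 4 * Real.exp (-(u / 4)) ≤ 128 / (c ^ 2 * a) * τ⁻¹ := by
    have h1 := Real.quadratic_le_exp_of_nonneg (by positivity : 0 ≤ u / 4)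
    have h2 : c ^ 2 * a * τ ≤ u ^ 2 := by
      calc c ^ 2 * a * τ = c ^ 2 * (a * τ) := by ring
        _ ≤ c ^ 2 * R ^ 2 := by
          rw [hR2]; gcongr; exact hw1.trans (le_max_right _ _)
        _ = (c * R) ^ 2 := by ring
        _ ≤ u ^ 2 := by gcongr
    rw [Real.exp_neg, ← div_eq_mul_inv, ← div_eq_mul_inv, div_div,
      div_le_div_iff₀ (Real.exp_pos _) (by positivity)]
    have h3 : u ^ 2 / 32 ≤ Real.exp (u / 4) := by
      have : u ^ 2 / 32 = (u / 4) ^ 2 / 2 := by ring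
      linarith
    linarith
  have e3 : 4 / u + Real.exp (-(u / 4)) ≤ 8 / u := by
    have h1 := Real.add_one_le_exp (u / 4)
    have h2 : Real.exp (-(u / 4)) ≤ 4 / u := by
      rw [Real.exp_neg, inv_eq_one_div, div_le_div_iff₀ (Real.exp_pos _) hu0]
      linarith
    calc 4 / u + Real.exp (-(u / 4)) ≤ 4 / u + 4 / u := by gcongr
      _ = 8 / u := by ring
  have e4 : σ ^ 2 * (8 / u) ≤ L ^ 2 * (8 * B ^ (d + 1) / c * τ⁻¹) := by
    have hσL : σ ^ 2 * τ ^ (d + 2) = n * L ^ 2 := by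
      rw [hτΛ, hΛ]; field_simp
    have h1 : c ≤ γ * (B * τ) ^ (d - 1) := hγR.trans (by gcongr)
    have hBτ : 1 ≤ B * τ := hτB.trans (mul_le_mul_of_nonneg_right (by linarith) hτ0.le)
    have h2 : c * τ ≤ γ * (B ^ (d + 1) * τ ^ (d + 2)) := by
      calc c * τ ≤ γ * (B * τ) ^ (d - 1) * τ := by gcongr
        _ ≤ γ * (B * τ) ^ (d + 1) * τ := by
          gcongr
          omega
        _ = _ := by rw [mul_pow]; ring
    have h3 : σ ^ 2 * (c * τ) ≤ L ^ 2 * B ^ (d + 1) * u := by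
      calc σ ^ 2 * (c * τ) ≤ σ ^ 2 * (γ * (B ^ (d + 1) * τ ^ (d + 2))) := by gcongr
        _ = γ * B ^ (d + 1) * (σ ^ 2 * τ ^ (d + 2)) := by ring
        _ = _ := by rw [hσL, hu]; ring
    have h4 : σ ^ 2 * (8 / u) = 8 * σ ^ 2 / u := by ring
    have h5 : L ^ 2 * (8 * B ^ (d + 1) / c * τ⁻¹) = 8 * (L ^ 2 * B ^ (d + 1)) / (c * τ) := by
      field_simp
    rw [h4, h5, div_le_div_iff₀ hu0 (by positivity)]
    linarith
  calc L ^ 2 * (16 * K / w + 4 * Real.exp (-(u / 4))) +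
        σ ^ 2 * (4 / u + Real.exp (-(u / 4)))
      ≤ L ^ 2 * (16 * K / a * τ⁻¹ + 128 / (c ^ 2 * a) * τ⁻¹) +
        L ^ 2 * (8 * B ^ (d + 1) / c * τ⁻¹) := by
        refine add_le_add (mul_le_mul_of_nonneg_left (add_le_add e1 e2) (sq_nonneg L)) ?_
        exact (mul_le_mul_of_nonneg_left e3 (sq_nonneg σ)).trans e4
    _ = _ := by ring
end
end

section
/- (Lower bound for linear attention.) Suppose the tasks are drawn from the ReLU task distribution D(F^+_L) with L > 0, the covariates x_1,…,x_{n+1} are i.i.d. uniform on S^{d−1}, and the noises ε_1,…,ε_n are i.i.d., symmetric about 0 (ε and −ε have the same law), square-integrable, and independent of everything else. Then for every matrix M ∈ ℝ^{d×d}, the linear-attention ICL loss satisfies L_LA(M) := E[( Σ_{i=1}^n (f(x_i)+ε_i)·x_i^⊤ M x_{n+1} − f(x_{n+1}) )²] ≥ L²/3. -/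
open MeasureTheory Real

noncomputable section

/-- The parameter distribution of the ReLU task class `D(F^+_L)`. -/
def reluTask (d : ℕ) (L : ℝ) : Measure (EuclideanSpace ℝ (Fin d) × ℝ × ℝ × ℝ) :=
  (sphereUniform d).prod ((unifIcc L).prod ((unifIcc L).prod (unifIcc L)))

/-- The ReLU task function `f(x) = l₁ max(vᵀx, 0) + l₂ max(-vᵀx, 0) + b`. -/
def reluF {d : ℕ} (θ : EuclideanSpace ℝ (Fin d) × ℝ × ℝ × ℝ)
    (x : EuclideanSpace ℝ (Fin d)) : ℝ :=
  θ.2.1 * max (∑ a, θ.1 a * x a) 0 + θ.2.2.1 * max (-(∑ a, θ.1 a * x a)) 0 + θ.2.2.2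

/-- The linear-attention prediction of the label of the query `x (Fin.last n)` from the
labelled context `{(x_i, y_i)}_{i=1}^n`. -/
def linPred {d n : ℕ} (M : Matrix (Fin d) (Fin d) ℝ)
    (x : Fin (n + 1) → EuclideanSpace ℝ (Fin d)) (y : Fin n → ℝ) : ℝ :=
  ∑ i : Fin n, y i * quadForm M (x i.castSucc) (x (Fin.last n))

/-- The linear-attention ICL loss with tasks drawn from `τ`, i.i.d. uniform-sphere
covariates and i.i.d. noise `ν`. -/
def linLoss (d n : ℕ) {Θ : Type*} [MeasurableSpace Θ] (τ : Measure Θ) (ν : Measure ℝ)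
    (F : Θ → EuclideanSpace ℝ (Fin d) → ℝ) (M : Matrix (Fin d) (Fin d) ℝ) : ℝ :=
  ∫ θ, ∫ x : Fin (n + 1) → EuclideanSpace ℝ (Fin d), ∫ e : Fin n → ℝ,
      (linPred M x (fun i => F θ (x i.castSucc) + e i) - F θ (x (Fin.last n))) ^ 2
        ∂(Measure.pi fun _ : Fin n => ν)
      ∂(Measure.pi fun _ : Fin (n + 1) => sphereUniform d) ∂τ

section SphereHausdorff

open Module Metric
open scoped ENNReal

variable {E : Type*} [NormedAddCommGroup E] [InnerProductSpace ℝ E] [FiniteDimensional ℝ E]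
  [MeasurableSpace E] [BorelSpace E]

/-- The half sphere facing away from `v` has finite Hausdorff measure of codimension one: it is
the Lipschitz image of a ball under the inverse stereographic projection from `v`. -/
lemma hausdorffMeasure_halfSphere_lt_top {m : ℕ} (hE : finrank ℝ E = m + 1) {v : E}
    (hv : ‖v‖ = 1) :
    μH[(m : ℝ)] (sphere (0 : E) 1 ∩ {x | inner ℝ v x ≤ 0}) < ∞ := by
  have : Fact (finrank ℝ E = m + 1) := ⟨hE⟩
  have hv0 : v ≠ 0 := by rintro rfl; simp at hv
  have hK : finrank ℝ (ℝ ∙ v)ᗮ = m := Submodule.finrank_orthogonal_span_singleton hv0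
  have hcd : ContDiff ℝ 1 (stereoInvFunAux v ∘ ((↑) : (ℝ ∙ v)ᗮ → E)) :=
    contDiff_stereoInvFunAux.comp (ℝ ∙ v)ᗮ.subtypeL.contDiff
  obtain ⟨C, hC⟩ := hcd.contDiffOn.exists_lipschitzOnWith one_ne_zero
    (convex_closedBall (0 : (ℝ ∙ v)ᗮ) 2) (isCompact_closedBall _ _)
  have hball : μH[(m : ℝ)] (closedBall (0 : (ℝ ∙ v)ᗮ) 2) < ∞ := by
    rw [← hK]
    exact (isCompact_closedBall _ _).measure_lt_top
  refine (measure_mono ?_).trans_lt ((hC.hausdorffMeasure_image_le m.cast_nonneg).trans_lt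
    (ENNReal.mul_lt_top (ENNReal.rpow_lt_top_of_nonneg m.cast_nonneg ENNReal.coe_ne_top) hball))
  rintro x ⟨hx, hvx⟩
  have hvx : inner ℝ v x ≤ 0 := hvx
  have hxv : x ≠ v := by
    rintro rfl
    rw [real_inner_self_eq_norm_sq, hv] at hvx
    norm_num at hvx
  refine ⟨stereoToFun v x, ?_,
    congrArg Subtype.val (stereo_left_inv hv (x := ⟨x, hx⟩) hxv)⟩
  have h1 : ‖(ℝ ∙ v)ᗮ.orthogonalProjectionOnto x‖ ≤ 1 :=
    ((ℝ ∙ v)ᗮ.norm_orthogonalProjectionOnto_apply_le x).trans (by simpa using hx.le)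
  rw [mem_closedBall_zero_iff, stereoToFun_apply, norm_smul, innerSL_apply_apply, Real.norm_eq_abs,
    abs_of_nonneg (by apply div_nonneg <;> linarith)]
  have h2 : 2 / (1 - inner ℝ v x) ≤ 2 := by
    rw [div_le_iff₀] <;> linarith
  nlinarith [norm_nonneg ((ℝ ∙ v)ᗮ.orthogonalProjectionOnto x)]

lemma hausdorffMeasure_sphere_lt_top {m : ℕ} (hE : finrank ℝ E = m + 1) :
    μH[(m : ℝ)] (sphere (0 : E) 1) < ∞ := by
  have : Nontrivial E := Module.nontrivial_of_finrank_pos (R := ℝ) (by omega)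
  obtain ⟨v, hv⟩ := exists_norm_eq E zero_le_one
  refine (measure_mono ?_).trans_lt (measure_union_lt_top
    (hausdorffMeasure_halfSphere_lt_top hE hv)
    (hausdorffMeasure_halfSphere_lt_top hE (v := -v) (by simpa using hv)))
  intro x hx
  rcases le_total (inner ℝ v x) 0 with h | h
  · exact Or.inl ⟨hx, h⟩
  · exact Or.inr ⟨hx, by simpa [inner_neg_left] using h⟩

/-- The orthogonal projection to a hyperplane maps the sphere onto a ball without increasing
distances, so the sphere has positive Hausdorff measure of codimension one. -/
lemma hausdorffMeasure_sphere_pos {m : ℕ} (hE : finrank ℝ E = m + 1) :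
    0 < μH[(m : ℝ)] (sphere (0 : E) 1) := by
  have : Nontrivial E := Module.nontrivial_of_finrank_pos (R := ℝ) (by omega)
  have : Fact (finrank ℝ E = m + 1) := ⟨hE⟩
  obtain ⟨v, hv⟩ := exists_norm_eq E zero_le_one
  have hv0 : v ≠ 0 := by rintro rfl; simp at hv
  have hK : finrank ℝ (ℝ ∙ v)ᗮ = m := Submodule.finrank_orthogonal_span_singleton hv0
  have hball : 0 < μH[(m : ℝ)] (ball (0 : (ℝ ∙ v)ᗮ) 1) := by
    rw [← hK]
    exact measure_ball_pos _ _ one_pos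
  have hlip : LipschitzWith 1 (ℝ ∙ v)ᗮ.orthogonalProjectionOnto :=
    (ℝ ∙ v)ᗮ.lipschitzWith_orthogonalProjectionOnto
  have hle := hlip.hausdorffMeasure_image_le (m.cast_nonneg : (0 : ℝ) ≤ m) (sphere (0 : E) 1)
  rw [ENNReal.coe_one, ENNReal.one_rpow, one_mul] at hle
  refine hball.trans_le (le_trans (measure_mono ?_) hle)
  intro w hw
  have hw1 : ‖w‖ < 1 := by simpa using hw
  refine ⟨(w : E) + √(1 - ‖w‖ ^ 2) • v, ?_, ?_⟩
  · have hwv : inner ℝ (w : E) v = 0 := Submodule.mem_orthogonal_singleton_iff_inner_left.mp w.2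
    have hs : √(1 - ‖w‖ ^ 2) ^ 2 = 1 - ‖w‖ ^ 2 := Real.sq_sqrt (by nlinarith [norm_nonneg w])
    have : ‖(w : E) + √(1 - ‖w‖ ^ 2) • v‖ ^ 2 = 1 := by
      rw [norm_add_sq_real, inner_smul_right, hwv, norm_smul, hv, Real.norm_eq_abs, mul_one, sq_abs,
        hs, Submodule.coe_norm]
      ring
    rw [mem_sphere_zero_iff_norm]
    nlinarith [norm_nonneg ((w : E) + √(1 - ‖w‖ ^ 2) • v)]
  · simp [Submodule.orthogonalProjectionOnto_orthogonalComplement_singleton_eq_zero v]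

end SphereHausdorff

lemma isProbabilityMeasure_sphereUniform {d : ℕ} (hd : 1 ≤ d) :
    IsProbabilityMeasure (sphereUniform d) := by
  obtain ⟨m, rfl⟩ := Nat.exists_eq_add_of_le' hd
  have hE : Module.finrank ℝ (EuclideanSpace ℝ (Fin (m + 1))) = m + 1 := by simp
  have hm : ((m + 1 : ℕ) : ℝ) - 1 = m := by push_cast; ring
  constructor
  rw [sphereUniform, hm, Measure.smul_apply, Measure.restrict_apply_univ, smul_eq_mul]
  exact ENNReal.inv_mul_cancel (hausdorffMeasure_sphere_pos hE).ne'
    (hausdorffMeasure_sphere_lt_top hE).ne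

lemma ae_sphereUniform_mem_sphere (d : ℕ) :
    ∀ᵐ x ∂sphereUniform d, x ∈ Metric.sphere (0 : EuclideanSpace ℝ (Fin d)) 1 :=
  Measure.ae_smul_measure (ae_restrict_mem Metric.isClosed_sphere.measurableSet) _

lemma measurePreserving_neg_sphereUniform (d : ℕ) :
    MeasurePreserving (fun x => -x) (sphereUniform d) (sphereUniform d) := by
  have h := ((IsometryEquiv.neg (EuclideanSpace ℝ (Fin d))).measurePreserving_hausdorffMeasure
    ((d : ℝ) - 1)).restrict_preimage
    (Metric.isClosed_sphere (x := (0 : EuclideanSpace ℝ (Fin d))) (ε := 1)).measurableSet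
  have hs : (IsometryEquiv.neg (EuclideanSpace ℝ (Fin d))) ⁻¹' Metric.sphere 0 1 =
      Metric.sphere 0 1 := by
    ext x; simp
  rw [hs] at h
  exact h.smul_measure _

lemma isProbabilityMeasure_unifIcc {L : ℝ} (hL : 0 < L) : IsProbabilityMeasure (unifIcc L) := by
  constructor
  rw [unifIcc, Measure.smul_apply, Measure.restrict_apply_univ, Real.volume_Icc, smul_eq_mul,
    sub_neg_eq_add, ← two_mul]
  exact ENNReal.inv_mul_cancel (by simpa using hL) ENNReal.ofReal_ne_top

lemma ae_unifIcc_mem_Icc (L : ℝ) : ∀ᵐ t ∂unifIcc L, t ∈ Set.Icc (-L) L :=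
  Measure.ae_smul_measure (ae_restrict_mem measurableSet_Icc) _

lemma measurePreserving_neg_unifIcc (L : ℝ) :
    MeasurePreserving (fun t => -t) (unifIcc L) (unifIcc L) := by
  have h := (Measure.measurePreserving_neg (volume : Measure ℝ)).restrict_preimage
    (measurableSet_Icc (a := -L) (b := L))
  have hs : Neg.neg ⁻¹' Set.Icc (-L) L = Set.Icc (-L) L := by
    ext x; simp [and_comm]
  rw [hs] at h
  exact h.smul_measure _

lemma integral_sq_unifIcc {L : ℝ} (hL : 0 < L) : ∫ t, t ^ 2 ∂unifIcc L = L ^ 2 / 3 := by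
  rw [unifIcc, integral_smul_measure, integral_Icc_eq_integral_Ioc,
    ← intervalIntegral.integral_of_le (by linarith), integral_pow, ENNReal.toReal_inv,
    ENNReal.toReal_ofReal (by linarith), smul_eq_mul]
  field_simp
  push_cast
  ring

section Averaging

variable {α β γ : Type*} [MeasurableSpace α] [MeasurableSpace β] [MeasurableSpace γ]

lemma integral_integral_integral {τ : Measure α} {κ : Measure β} {ρ : Measure γ}
    [SFinite τ] [SFinite κ] [SFinite ρ] {f : α → β → γ → ℝ}
    (hf : Integrable (fun p : α × β × γ => f p.1 p.2.1 p.2.2) (τ.prod (κ.prod ρ))) :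
    ∫ a, ∫ b, ∫ c, f a b c ∂ρ ∂κ ∂τ = ∫ p, f p.1 p.2.1 p.2.2 ∂τ.prod (κ.prod ρ) := by
  rw [integral_prod _ hf]
  refine integral_congr_ae ?_
  filter_upwards [hf.prod_right_ae] with a ha
  exact (integral_prod _ ha).symm

lemma integral_comp_of_measurePreserving {μ : Measure α} {T : α → α}
    (hT : MeasurePreserving T μ μ) {g : α → ℝ} (hg : AEStronglyMeasurable g μ) :
    ∫ p, g (T p) ∂μ = ∫ p, g p ∂μ := by
  rw [← integral_map hT.aemeasurable (by rwa [hT.map_eq]), hT.map_eq]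

/-- Averaging over two measure-preserving maps bounds an integral from below. -/
lemma integral_le_of_le_average {μ : Measure α} {T S : α → α} (hT : MeasurePreserving T μ μ)
    (hS : MeasurePreserving S μ μ) {g h : α → ℝ} (hg : Integrable g μ) (hh : Integrable h μ)
    (hle : ∀ p, 4 * h p ≤ (g p + g (T p)) + (g (S p) + g (T (S p)))) :
    ∫ p, h p ∂μ ≤ ∫ p, g p ∂μ := by
  have hgT : Integrable (fun p => g (T p)) μ := hT.integrable_comp_of_integrable hg
  have hA : Integrable (fun p => g p + g (T p)) μ := hg.add hgT
  have hAS : Integrable (fun p => g (S p) + g (T (S p))) μ := hS.integrable_comp_of_integrable hA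
  have h1 : ∫ p, g p + g (T p) ∂μ = 2 * ∫ p, g p ∂μ := by
    rw [integral_add hg hgT, integral_comp_of_measurePreserving hT hg.aestronglyMeasurable]
    ring
  have h2 := integral_comp_of_measurePreserving hS hA.aestronglyMeasurable
  have h3 := integral_mono (hh.const_mul 4) (hA.add hAS) hle
  have h4 : ∫ p, ((fun p => g p + g (T p)) + fun p => g (S p) + g (T (S p))) p ∂μ =
      4 * ∫ p, g p ∂μ := by
    rw [integral_add' hA hAS, h2, h1]
    ring
  rw [h4, integral_const_mul] at h3
  linarith

/-- A continuous function is bounded almost everywhere under a measure carried by a compact set. -/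
lemma memLp_top_of_continuous_of_ae_mem_isCompact [TopologicalSpace α] [OpensMeasurableSpace α]
    {μ : Measure α} {K : Set α} (hK : IsCompact K) (hμ : ∀ᵐ a ∂μ, a ∈ K) {φ : α → ℝ}
    (hφ : Continuous φ) : MemLp φ ⊤ μ := by
  obtain ⟨C, hC⟩ := hK.exists_bound_of_continuousOn hφ.continuousOn
  exact memLp_top_of_bound hφ.measurable.aestronglyMeasurable C (hμ.mono hC)

lemma ae_prod_mem_prod {μ : Measure α} {κ : Measure β} [SFinite μ] [SFinite κ]
    {s : Set α} {t : Set β}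
    (hs : ∀ᵐ a ∂μ, a ∈ s) (ht : ∀ᵐ b ∂κ, b ∈ t) : ∀ᵐ p ∂μ.prod κ, p ∈ s ×ˢ t :=
  (Measure.quasiMeasurePreserving_fst.ae hs).and (Measure.quasiMeasurePreserving_snd.ae ht)

end Averaging

section Parity

variable {d n : ℕ}

lemma quadForm_neg_right (M : Matrix (Fin d) (Fin d) ℝ) (x y : EuclideanSpace ℝ (Fin d)) :
    quadForm M x (-y) = -quadForm M x y := by
  simp [quadForm]

lemma continuous_quadForm (M : Matrix (Fin d) (Fin d) ℝ) :
    Continuous fun p : EuclideanSpace ℝ (Fin d) × EuclideanSpace ℝ (Fin d) =>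
      quadForm M p.1 p.2 := by
  unfold quadForm
  fun_prop

lemma continuous_reluF :
    Continuous fun p : (EuclideanSpace ℝ (Fin d) × ℝ × ℝ × ℝ) × EuclideanSpace ℝ (Fin d) =>
      reluF p.1 p.2 := by
  unfold reluF
  fun_prop

/-- Negates the last point of a tuple. -/
def negLast (x : Fin (n + 1) → EuclideanSpace ℝ (Fin d)) :
    Fin (n + 1) → EuclideanSpace ℝ (Fin d) :=
  fun i => (if i = Fin.last n then fun y => -y else id) (x i)

@[simp]
lemma negLast_last (x : Fin (n + 1) → EuclideanSpace ℝ (Fin d)) :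
    negLast x (Fin.last n) = -x (Fin.last n) := by
  simp [negLast]

@[simp]
lemma negLast_castSucc (x : Fin (n + 1) → EuclideanSpace ℝ (Fin d)) (i : Fin n) :
    negLast x i.castSucc = x i.castSucc := by
  simp [negLast, i.castSucc_lt_last.ne]

lemma measurePreserving_negLast [IsProbabilityMeasure (sphereUniform d)] :
    MeasurePreserving (negLast (d := d) (n := n)) (Measure.pi fun _ => sphereUniform d)
      (Measure.pi fun _ => sphereUniform d) := by
  refine measurePreserving_pi _ _ fun i => ?_
  split_ifs
  · exact measurePreserving_neg_sphereUniform d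
  · exact MeasurePreserving.id _

lemma linPred_negLast (M : Matrix (Fin d) (Fin d) ℝ)
    (x : Fin (n + 1) → EuclideanSpace ℝ (Fin d)) (y : Fin n → ℝ) :
    linPred M (negLast x) y = -linPred M x y := by
  simp [linPred, quadForm_neg_right]

lemma reluF_eq_even_add_odd (v : EuclideanSpace ℝ (Fin d)) (l₁ l₂ b : ℝ)
    (x : EuclideanSpace ℝ (Fin d)) :
    reluF (v, l₁, l₂, b) x = (l₁ + l₂) / 2 * |∑ a, v a * x a| + b
      + (l₁ - l₂) / 2 * ∑ a, v a * x a := by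
  simp only [reluF]
  rcases le_total 0 (∑ a, v a * x a) with h | h
  · rw [max_eq_left h, max_eq_right (by linarith), abs_of_nonneg h]
    ring
  · rw [max_eq_right h, max_eq_left (by linarith), abs_of_nonpos h]
    ring

end Parity

section Integrability

variable {d n : ℕ} {L : ℝ} {ν : Measure ℝ}

/-- The prediction error of linear attention, as a function of task, covariates and noises. -/
def linError (M : Matrix (Fin d) (Fin d) ℝ) (θ : EuclideanSpace ℝ (Fin d) × ℝ × ℝ × ℝ)
    (x : Fin (n + 1) → EuclideanSpace ℝ (Fin d)) (e : Fin n → ℝ) : ℝ :=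
  linPred M x (fun i => reluF θ (x i.castSucc) + e i) - reluF θ (x (Fin.last n))

lemma sq_le_average_linError (M : Matrix (Fin d) (Fin d) ℝ) (v : EuclideanSpace ℝ (Fin d))
    (l₁ l₂ b : ℝ) (x : Fin (n + 1) → EuclideanSpace ℝ (Fin d)) (e : Fin n → ℝ) :
    4 * b ^ 2 ≤ (linError M (v, l₁, l₂, b) x e ^ 2 + linError M (v, l₁, l₂, b) (negLast x) e ^ 2)
      + (linError M (v, l₁, l₂, -b) x e ^ 2 + linError M (v, l₁, l₂, -b) (negLast x) e ^ 2) := by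
  have hneg : ∀ y : EuclideanSpace ℝ (Fin d), ∑ a, v a * (-y) a = -∑ a, v a * y a := by
    intro y; simp
  simp only [linError, linPred_negLast, negLast_castSucc, negLast_last]
  generalize linPred M x _ = P
  generalize linPred M x _ = Q
  simp only [reluF_eq_even_add_odd, hneg, abs_neg]
  generalize ∑ a, v a * x (Fin.last n) a = t
  nlinarith [sq_nonneg (P - (l₁ - l₂) / 2 * t), sq_nonneg (Q - (l₁ - l₂) / 2 * t),
    sq_nonneg ((l₁ + l₂) / 2 * |t|)]

lemma ae_reluTask_prod_mem [IsProbabilityMeasure (sphereUniform d)]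
    [IsProbabilityMeasure (unifIcc L)] :
    ∀ᵐ p ∂(reluTask d L).prod (Measure.pi fun _ : Fin (n + 1) => sphereUniform d),
      p ∈ (Metric.sphere 0 1 ×ˢ Set.Icc (-L) L ×ˢ Set.Icc (-L) L ×ˢ Set.Icc (-L) L) ×ˢ
        (Set.univ.pi fun _ => Metric.sphere 0 1) := by
  unfold reluTask
  refine ae_prod_mem_prod (ae_prod_mem_prod (ae_sphereUniform_mem_sphere d)
    (ae_prod_mem_prod (ae_unifIcc_mem_Icc L)
      (ae_prod_mem_prod (ae_unifIcc_mem_Icc L) (ae_unifIcc_mem_Icc L)))) ?_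
  have h : ∀ᵐ x ∂Measure.pi fun _ : Fin (n + 1) => sphereUniform d, ∀ i,
      x i ∈ Metric.sphere (0 : EuclideanSpace ℝ (Fin d)) 1 :=
    ae_all_iff.2 fun i => (Measure.quasiMeasurePreserving_eval _ i).ae
      (ae_sphereUniform_mem_sphere d)
  filter_upwards [h] with x hx i _ using hx i

instance [IsProbabilityMeasure (sphereUniform d)] [IsProbabilityMeasure (unifIcc L)] :
    IsProbabilityMeasure (reluTask d L) := by
  unfold reluTask; infer_instance

/-- A continuous function of task and covariates is bounded almost everywhere. -/
lemma memLp_top_of_continuous_task_covariates [IsProbabilityMeasure (sphereUniform d)]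
    [IsProbabilityMeasure (unifIcc L)] [IsProbabilityMeasure ν]
    {φ : (EuclideanSpace ℝ (Fin d) × ℝ × ℝ × ℝ) × (Fin (n + 1) → EuclideanSpace ℝ (Fin d)) → ℝ}
    (hφ : Continuous φ) :
    MemLp (fun p : (EuclideanSpace ℝ (Fin d) × ℝ × ℝ × ℝ) ×
        (Fin (n + 1) → EuclideanSpace ℝ (Fin d)) × (Fin n → ℝ) => φ (p.1, p.2.1)) ⊤
      ((reluTask d L).prod ((Measure.pi fun _ => sphereUniform d).prod
        (Measure.pi fun _ => ν))) := by
  have hK := (((isCompact_sphere (0 : EuclideanSpace ℝ (Fin d)) 1).prod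
    ((isCompact_Icc (a := -L) (b := L)).prod ((isCompact_Icc (a := -L) (b := L)).prod
      (isCompact_Icc (a := -L) (b := L))))).prod (isCompact_univ_pi fun _ : Fin (n + 1) =>
        isCompact_sphere (0 : EuclideanSpace ℝ (Fin d)) 1))
  have h := memLp_top_of_continuous_of_ae_mem_isCompact hK ae_reluTask_prod_mem hφ
  exact h.comp_measurePreserving ((MeasurePreserving.id _).prod measurePreserving_fst)

lemma memLp_linError [IsProbabilityMeasure (sphereUniform d)] [IsProbabilityMeasure (unifIcc L)]
    [IsProbabilityMeasure ν] (hsq : Integrable (fun t : ℝ => t ^ 2) ν)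
    (M : Matrix (Fin d) (Fin d) ℝ) :
    MemLp (fun p : (EuclideanSpace ℝ (Fin d) × ℝ × ℝ × ℝ) ×
        (Fin (n + 1) → EuclideanSpace ℝ (Fin d)) × (Fin n → ℝ) => linError M p.1 p.2.1 p.2.2) 2
      ((reluTask d L).prod ((Measure.pi fun _ => sphereUniform d).prod
        (Measure.pi fun _ => ν))) := by
  have hnoise (i : Fin n) : MemLp (fun p : (EuclideanSpace ℝ (Fin d) × ℝ × ℝ × ℝ) ×
      (Fin (n + 1) → EuclideanSpace ℝ (Fin d)) × (Fin n → ℝ) => p.2.2 i) 2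
      ((reluTask d L).prod ((Measure.pi fun _ => sphereUniform d).prod
        (Measure.pi fun _ => ν))) :=
    ((memLp_two_iff_integrable_sq aestronglyMeasurable_id).2 hsq).comp_measurePreserving
      ((measurePreserving_eval (fun _ => ν) i).comp
        (measurePreserving_snd.comp measurePreserving_snd))
  have hrelu (i : Fin (n + 1)) :=
    memLp_top_of_continuous_task_covariates (L := L) (ν := ν)
      (φ := fun q : (EuclideanSpace ℝ (Fin d) × ℝ × ℝ × ℝ) ×
        (Fin (n + 1) → EuclideanSpace ℝ (Fin d)) => reluF q.1 (q.2 i))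
      (continuous_reluF.comp (continuous_fst.prodMk ((continuous_apply i).comp continuous_snd)))
  have hquad (i : Fin (n + 1)) :=
    memLp_top_of_continuous_task_covariates (L := L) (ν := ν)
      (φ := fun q : (EuclideanSpace ℝ (Fin d) × ℝ × ℝ × ℝ) ×
        (Fin (n + 1) → EuclideanSpace ℝ (Fin d)) => quadForm M (q.2 i) (q.2 (Fin.last n)))
      ((continuous_quadForm M).comp
        (f := fun q : (EuclideanSpace ℝ (Fin d) × ℝ × ℝ × ℝ) ×
          (Fin (n + 1) → EuclideanSpace ℝ (Fin d)) => (q.2 i, q.2 (Fin.last n))) (by fun_prop))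
  have hterm (i : Fin n) :=
    MemLp.mul' (r := 2) (hquad i.castSucc)
      (((hrelu i.castSucc).mono_exponent le_top).add (hnoise i))
  exact (memLp_finsetSum _ fun i _ => hterm i).sub ((hrelu _).mono_exponent le_top)

end Integrability

/-- Theorem 6: lower bound for linear attention. On tasks drawn from `D(F^+_L)` with
symmetric square-integrable noise, the linear-attention ICL loss of every matrix `M`
is at least `L²/3`. -/
theorem linear_attention_lower_bound (d n : ℕ) (hd : 2 ≤ d) (hn : 1 ≤ n)
    (L : ℝ) (hL : 0 < L) (ν : Measure ℝ)
    (hprob : IsProbabilityMeasure ν)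
    (hsymm : ν.map (fun t : ℝ => -t) = ν)
    (hsq : Integrable (fun t : ℝ => t ^ 2) ν)
    (M : Matrix (Fin d) (Fin d) ℝ) :
    L ^ 2 / 3 ≤ linLoss d n (reluTask d L) ν reluF M := by
  have := isProbabilityMeasure_sphereUniform (d := d) (by omega)
  have := isProbabilityMeasure_unifIcc hL
  have hint := (memLp_linError (n := n) (L := L) hsq M).integrable_sq
  have hT := (MeasurePreserving.id (reluTask d L)).prod
    ((measurePreserving_negLast (d := d) (n := n)).prod
      (MeasurePreserving.id (Measure.pi fun _ : Fin n => ν)))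
  have hSτ : MeasurePreserving (Prod.map id (Prod.map id (Prod.map id fun t => -t)))
      (reluTask d L) (reluTask d L) :=
    (MeasurePreserving.id (sphereUniform d)).prod ((MeasurePreserving.id (unifIcc L)).prod
      ((MeasurePreserving.id (unifIcc L)).prod (measurePreserving_neg_unifIcc L)))
  have hB : MeasurePreserving (fun p : (EuclideanSpace ℝ (Fin d) × ℝ × ℝ × ℝ) ×
      (Fin (n + 1) → EuclideanSpace ℝ (Fin d)) × (Fin n → ℝ) => p.1.2.2.2)
      ((reluTask d L).prod ((Measure.pi fun _ => sphereUniform d).prod (Measure.pi fun _ => ν)))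
      (unifIcc L) :=
    measurePreserving_snd.comp (measurePreserving_snd.comp
      (measurePreserving_snd.comp measurePreserving_fst))
  have hb : Integrable (fun t : ℝ => t ^ 2) (unifIcc L) :=
    (memLp_top_of_continuous_of_ae_mem_isCompact isCompact_Icc (ae_unifIcc_mem_Icc L)
      (continuous_pow 2)).integrable le_top
  have hbB := hB.integrable_comp_of_integrable hb
  have hloss : linLoss d n (reluTask d L) ν reluF M = _ := integral_integral_integral hint
  rw [hloss, ← integral_sq_unifIcc hL, ← hB.map_eq,
    integral_map hB.aemeasurable (by rw [hB.map_eq]; exact hb.aestronglyMeasurable)]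
  exact integral_le_of_le_average hT (hSτ.prod (MeasurePreserving.id _)) hint hbB fun p =>
    sq_le_average_linError M p.1.1 p.1.2.1 p.1.2.2.1 p.1.2.2.2 p.2.1 p.2.2
end
end

section
/- (Signal term, affine tasks, upper bound.) There exists a constant C > 0 depending only on d such that: (i) for every w ≥ 0 and every L > 0, L_b(w; D(F^aff_L)) ≤ 4L²; and (ii) if w ≥ (d+√d)/2, n > 5, and 45·√d·w^{d/2} ≤ n/log n, then L_b(w; D(F^aff_L)) ≤ C·L²·( 1/w² + w^{d/2−1}/n + 1/n ). -/
open MeasureTheory Real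

noncomputable section

/-- The softmax attention weight
`γ_i(w) = exp(-w ‖x_i - x_{n+1}‖²) / Σ_j exp(-w ‖x_j - x_{n+1}‖²)`. -/
def attnW {d n : ℕ} (w : ℝ) (x : Fin (n + 1) → EuclideanSpace ℝ (Fin d)) (i : Fin n) : ℝ :=
  Real.exp (-w * ‖x i.castSucc - x (Fin.last n)‖ ^ 2) /
    ∑ j : Fin n, Real.exp (-w * ‖x j.castSucc - x (Fin.last n)‖ ^ 2)

/-- The signal (bias) term `L_b(w; D)`: the task parameter `θ` is drawn from `τ`
(with task function `F θ`) and the covariates `x_1, …, x_{n+1}` are i.i.d. uniform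
on the sphere. -/
def signalTerm (d n : ℕ) {Θ : Type*} [MeasurableSpace Θ] (τ : Measure Θ)
    (F : Θ → EuclideanSpace ℝ (Fin d) → ℝ) (w : ℝ) : ℝ :=
  ∫ θ, ∫ x : Fin (n + 1) → EuclideanSpace ℝ (Fin d),
      (∑ i : Fin n, attnW w x i * (F θ (x (Fin.last n)) - F θ (x i.castSucc))) ^ 2
    ∂(Measure.pi fun _ : Fin (n + 1) => sphereUniform d) ∂τ

section Softmax

variable {E ι : Type*} [NormedAddCommGroup E] [Fintype ι]

/-- Softmax weights of the points `y i` with respect to the query point `e`. -/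
def softmaxWeight (w : ℝ) (e : E) (y : ι → E) (i : ι) : ℝ :=
  Real.exp (-w * ‖y i - e‖ ^ 2) / ∑ j, Real.exp (-w * ‖y j - e‖ ^ 2)

lemma softmaxWeight_nonneg (w : ℝ) (e : E) (y : ι → E) (i : ι) : 0 ≤ softmaxWeight w e y i := by
  unfold softmaxWeight; positivity

lemma sum_softmaxWeight [Nonempty ι] (w : ℝ) (e : E) (y : ι → E) :
    ∑ i, softmaxWeight w e y i = 1 := by
  have : 0 < ∑ j, Real.exp (-w * ‖y j - e‖ ^ 2) :=
    Finset.sum_pos (fun _ _ => Real.exp_pos _) Finset.univ_nonempty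
  simp only [softmaxWeight, ← Finset.sum_div]
  exact div_self this.ne'

lemma softmaxWeight_le_one [Nonempty ι] (w : ℝ) (e : E) (y : ι → E) (i : ι) :
    softmaxWeight w e y i ≤ 1 :=
  (Finset.single_le_sum (fun j _ => softmaxWeight_nonneg w e y j) (Finset.mem_univ i)).trans_eq
    (sum_softmaxWeight w e y)

section Measurability

variable [MeasurableSpace E] [BorelSpace E]

@[fun_prop]
lemma measurable_softmaxWeight_right (w : ℝ) (e : E) (i : ι) :
    Measurable fun y : ι → E => softmaxWeight w e y i := by
  unfold softmaxWeight; fun_prop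

end Measurability

variable [InnerProductSpace ℝ E]

lemma norm_sum_smul_sub_sq {e : E} (he : ‖e‖ = 1) (γ : ι → ℝ) (y : ι → E) :
    ‖∑ i, γ i • (e - y i)‖ ^ 2 = (∑ i, γ i * (1 - inner ℝ e (y i))) ^ 2 +
      ‖∑ i, γ i • (y i - inner ℝ e (y i) • e)‖ ^ 2 := by
  have h1 : ∑ i, γ i • (e - y i) = (∑ i, γ i * (1 - inner ℝ e (y i))) • e -
      ∑ i, γ i • (y i - inner ℝ e (y i) • e) := by
    rw [Finset.sum_smul, ← Finset.sum_sub_distrib]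
    refine Finset.sum_congr rfl fun i _ => ?_
    module
  have h2 : inner ℝ e (∑ i, γ i • (y i - inner ℝ e (y i) • e)) = (0 : ℝ) := by
    simp [inner_sum, inner_smul_right, inner_sub_right, he]
  rw [h1, norm_sub_sq_real, inner_smul_left, h2, norm_smul, he]
  simp

lemma norm_sum_smul_sq (γ : ι → ℝ) (p : ι → E) :
    ‖∑ i, γ i • p i‖ ^ 2 = ∑ i, ∑ j, γ i * γ j * inner ℝ (p i) (p j) := by
  rw [← real_inner_self_eq_norm_sq, sum_inner]
  refine Finset.sum_congr rfl fun i _ => ?_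
  rw [inner_sum]
  refine Finset.sum_congr rfl fun j _ => ?_
  rw [inner_smul_left, inner_smul_right]
  simp [mul_assoc]

lemma norm_sub_inner_smul_sq {e y : E} (he : ‖e‖ = 1) :
    ‖y - (inner ℝ e y : ℝ) • e‖ ^ 2 = ‖y‖ ^ 2 - (inner ℝ e y : ℝ) ^ 2 := by
  rw [norm_sub_sq_real, inner_smul_right, norm_smul, he, real_inner_comm]
  simp only [mul_one, Real.norm_eq_abs, sq_abs]
  ring

lemma norm_sum_softmaxWeight_smul_le [Nonempty ι] (w : ℝ) {e : E}
    (he : ‖e‖ = 1) {y : ι → E} (hy : ∀ i, ‖y i‖ = 1) :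
    ‖∑ i, softmaxWeight w e y i • (e - y i)‖ ≤ 2 := by
  calc _ ≤ ∑ i, softmaxWeight w e y i * 2 := by
        refine norm_sum_le_of_le _ fun i _ => ?_
        rw [norm_smul, Real.norm_of_nonneg (softmaxWeight_nonneg ..)]
        refine mul_le_mul_of_nonneg_left ?_ (softmaxWeight_nonneg ..)
        exact (norm_sub_le _ _).trans (by rw [he, hy]; norm_num)
    _ = 2 := by rw [← Finset.sum_mul, sum_softmaxWeight, one_mul]

lemma sum_sq_add_sum_le [Nonempty ι] {e : E} (he : ‖e‖ = 1) {y : ι → E} (hy : ∀ i, ‖y i‖ = 1)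
    (w : ℝ) {lam δ : ℝ} (hlam : 0 ≤ lam) (hδ : 0 < δ) :
    (∑ i, softmaxWeight w e y i * (1 - inner ℝ e (y i))) ^ 2 +
      ∑ i, softmaxWeight w e y i ^ 2 * ‖y i - (inner ℝ e (y i) : ℝ) • e‖ ^ 2 ≤
    (4 * δ)⁻¹ * ∑ i, Real.exp (-w * ‖y i - e‖ ^ 2) * ‖y i - e‖ ^ 4 +
      (δ ^ 2)⁻¹ * ∑ i, Real.exp (-w * ‖y i - e‖ ^ 2) ^ 2 * ‖y i - e‖ ^ 2 +
      8 * Real.exp (lam * δ) * ∏ i, Real.exp (-lam * Real.exp (-w * ‖y i - e‖ ^ 2)) := by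
  set D := ∑ j, Real.exp (-w * ‖y j - e‖ ^ 2) with hD
  have hin : ∀ i, 1 - inner ℝ e (y i) = ‖y i - e‖ ^ 2 / 2 := fun i => by
    rw [norm_sub_sq_real, hy, he, real_inner_comm]; ring
  have hle : ∀ i, ‖y i - e‖ ^ 2 ≤ 4 := fun i => by
    have : ‖y i - e‖ ≤ 2 := (norm_sub_le _ _).trans (by rw [hy, he]; norm_num)
    nlinarith [norm_nonneg (y i - e)]
  have hp : ∀ i, ‖y i - (inner ℝ e (y i) : ℝ) • e‖ ^ 2 ≤ ‖y i - e‖ ^ 2 := fun i => by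
    rw [norm_sub_inner_smul_sq he, hy]
    have := hin i
    nlinarith [sq_nonneg (1 - inner ℝ e (y i) : ℝ)]
  have h1 : (∑ i, softmaxWeight w e y i * (1 - inner ℝ e (y i))) ^ 2 ≤
      ∑ i, softmaxWeight w e y i * (‖y i - e‖ ^ 4 / 4) := by
    refine (Real.pow_arith_mean_le_arith_mean_pow _ _ _ (fun i _ => softmaxWeight_nonneg w e y i)
      (sum_softmaxWeight w e y) (fun i _ => by rw [hin]; positivity) 2).trans_eq ?_
    refine Finset.sum_congr rfl fun i _ => ?_
    rw [hin]; ring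
  have h2 : ∑ i, softmaxWeight w e y i ^ 2 * ‖y i - (inner ℝ e (y i) : ℝ) • e‖ ^ 2 ≤
      ∑ i, softmaxWeight w e y i ^ 2 * ‖y i - e‖ ^ 2 :=
    Finset.sum_le_sum fun i _ => mul_le_mul_of_nonneg_left (hp i) (sq_nonneg _)
  refine (add_le_add h1 h2).trans ?_
  have hprod : 8 * Real.exp (lam * δ) * ∏ i, Real.exp (-lam * Real.exp (-w * ‖y i - e‖ ^ 2)) =
      8 * Real.exp (lam * (δ - D)) := by
    rw [← Real.exp_sum, ← Finset.mul_sum, mul_assoc, ← Real.exp_add]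
    congr 2; ring
  rw [hprod]
  rcases le_or_gt δ D with h | h
  · have hγ : ∀ i, softmaxWeight w e y i ≤ δ⁻¹ * Real.exp (-w * ‖y i - e‖ ^ 2) := fun i => by
      rw [softmaxWeight, div_eq_inv_mul]; gcongr
    have h3 : ∑ i, softmaxWeight w e y i * (‖y i - e‖ ^ 4 / 4) ≤
        (4 * δ)⁻¹ * ∑ i, Real.exp (-w * ‖y i - e‖ ^ 2) * ‖y i - e‖ ^ 4 := by
      rw [Finset.mul_sum]
      refine Finset.sum_le_sum fun i _ => ?_
      calc _ ≤ δ⁻¹ * Real.exp (-w * ‖y i - e‖ ^ 2) * (‖y i - e‖ ^ 4 / 4) := by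
            gcongr; exact hγ i
        _ = _ := by rw [mul_inv]; ring
    have h4 : ∑ i, softmaxWeight w e y i ^ 2 * ‖y i - e‖ ^ 2 ≤
        (δ ^ 2)⁻¹ * ∑ i, Real.exp (-w * ‖y i - e‖ ^ 2) ^ 2 * ‖y i - e‖ ^ 2 := by
      rw [Finset.mul_sum]
      refine Finset.sum_le_sum fun i _ => ?_
      calc _ ≤ (δ⁻¹ * Real.exp (-w * ‖y i - e‖ ^ 2)) ^ 2 * ‖y i - e‖ ^ 2 := by
            gcongr
            · exact softmaxWeight_nonneg ..
            · exact hγ i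
        _ = _ := by rw [mul_pow, inv_pow]; ring
    have := Real.exp_pos (lam * (δ - D))
    linarith
  · have h3 : ∑ i, softmaxWeight w e y i * (‖y i - e‖ ^ 4 / 4) ≤ 4 := by
      calc _ ≤ ∑ i, softmaxWeight w e y i * 4 := by
            refine Finset.sum_le_sum fun i _ =>
              mul_le_mul_of_nonneg_left ?_ (softmaxWeight_nonneg ..)
            nlinarith [hle i, sq_nonneg ‖y i - e‖]
        _ = 4 := by rw [← Finset.sum_mul, sum_softmaxWeight, one_mul]
    have h4 : ∑ i, softmaxWeight w e y i ^ 2 * ‖y i - e‖ ^ 2 ≤ 4 := by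
      calc _ ≤ ∑ i, softmaxWeight w e y i * 4 := by
            refine Finset.sum_le_sum fun i _ => ?_
            have := softmaxWeight_le_one w e y i
            have h0 := softmaxWeight_nonneg w e y i
            exact mul_le_mul (by nlinarith) (hle i) (sq_nonneg _) h0
        _ = 4 := by rw [← Finset.sum_mul, sum_softmaxWeight, one_mul]
    have h5 : 1 ≤ Real.exp (lam * (δ - D)) := Real.one_le_exp (mul_nonneg hlam (by linarith))
    have h6 : 0 ≤ (4 * δ)⁻¹ * ∑ i, Real.exp (-w * ‖y i - e‖ ^ 2) * ‖y i - e‖ ^ 4 := by positivity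
    have h7 : 0 ≤ (δ ^ 2)⁻¹ * ∑ i, Real.exp (-w * ‖y i - e‖ ^ 2) ^ 2 * ‖y i - e‖ ^ 2 := by
      positivity
    linarith

end Softmax

lemma integral_sum_comp_eval {E : Type*} [MeasurableSpace E] {μ : Measure E} {ι : Type*} [Fintype ι]
    [IsProbabilityMeasure μ] {f : E → ℝ}
    (hf : Integrable f μ) :
    ∫ y, ∑ i, f (y i) ∂(Measure.pi fun _ : ι => μ) = Fintype.card ι * ∫ x, f x ∂μ := by
  rw [integral_finsetSum _ fun i _ => integrable_comp_eval (μ := fun _ : ι => μ) hf]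
  simp_rw [integral_comp_eval (μ := fun _ : ι => μ) hf.aestronglyMeasurable]
  simp

lemma two_add_pow_mul_exp_neg_sq_le (k : ℕ) {t : ℝ} (ht : 0 ≤ t) :
    (2 + t) ^ 4 * Real.exp (-t ^ 2) ≤
      ((k + 5).factorial * Real.exp 3) * (2 + t) ^ (-(k + 1 : ℝ)) := by
  have h1 : (2 + t) ^ (k + 5) ≤ (k + 5).factorial * Real.exp (2 + t) := by
    have := Real.pow_div_factorial_le_exp (2 + t) (by linarith) (k + 5)
    rwa [div_le_iff₀' (by positivity)] at this
  have h2 : Real.exp (2 + t) * Real.exp (-t ^ 2) ≤ Real.exp 3 := by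
    rw [← Real.exp_add]
    exact Real.exp_le_exp.2 (by nlinarith [sq_nonneg (t - 1 / 2)])
  rw [Real.rpow_neg (by linarith), ← div_eq_mul_inv, le_div_iff₀ (by positivity)]
  have h3 : (2 + t) ^ (k + 1 : ℝ) = (2 + t) ^ (k + 1) := by
    rw [← Real.rpow_natCast]; push_cast; rfl
  rw [h3]
  calc _ = (2 + t) ^ (k + 5) * Real.exp (-t ^ 2) := by ring
    _ ≤ (k + 5).factorial * Real.exp (2 + t) * Real.exp (-t ^ 2) := by gcongr
    _ = (k + 5).factorial * (Real.exp (2 + t) * Real.exp (-t ^ 2)) := by ring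
    _ ≤ _ := by gcongr

lemma integral_exp_neg_gaussian_le {E : Type*} [NormedAddCommGroup E] [MeasurableSpace E]
    [BorelSpace E] {μ : Measure E} [IsProbabilityMeasure μ] (e : E) {w : ℝ} (hw : 0 < w) :
    ∫ y, Real.exp (-Real.exp 4 * Real.exp (-w * ‖y - e‖ ^ 2)) ∂μ ≤
      Real.exp (-(μ.real (Metric.ball e (2 * (√w)⁻¹)) / 2)) := by
  set S := Metric.ball e (2 * (√w)⁻¹)
  have hS : MeasurableSet S := Metric.isOpen_ball.measurableSet
  have hi : Integrable (S.indicator fun _ => (1 / 2 : ℝ)) μ := (integrable_const _).indicator hS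
  calc _ ≤ ∫ y, (1 - S.indicator (fun _ => (1 / 2 : ℝ)) y) ∂μ := by
        refine integral_mono_of_nonneg (.of_forall fun y => (Real.exp_pos _).le)
          ((integrable_const _).sub hi) (.of_forall fun y => ?_)
        by_cases hy : y ∈ S
        · simp only [hy, Set.indicator_of_mem]
          rw [Metric.mem_ball, dist_eq_norm, ← div_eq_mul_inv, lt_div_iff₀ (by positivity)] at hy
          have h1 : w * ‖y - e‖ ^ 2 ≤ 4 := by
            have : (‖y - e‖ * √w) ^ 2 ≤ 2 ^ 2 := by gcongr
            rw [mul_pow, Real.sq_sqrt hw.le] at this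
            linarith
          have h2 : 1 ≤ Real.exp 4 * Real.exp (-w * ‖y - e‖ ^ 2) := by
            rw [← Real.exp_add]; exact Real.one_le_exp (by linarith)
          calc _ ≤ Real.exp (-1) := Real.exp_le_exp.2 (by linarith)
            _ ≤ 1 - 1 / 2 := by
              have := Real.exp_neg_one_lt_d9
              linarith
        · simp only [hy, not_false_eq_true, Set.indicator_of_notMem, sub_zero]
          exact Real.exp_le_one_iff.2 (by rw [neg_mul]; exact neg_nonpos.2 (by positivity))
    _ = 1 - μ.real S / 2 := by
        rw [integral_sub (integrable_const _) hi, integral_indicator_const _ hS]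
        simp [div_eq_mul_inv]
    _ ≤ _ := Real.one_sub_le_exp_neg _

section RotationInvariant

variable {E : Type*} [NormedAddCommGroup E] [InnerProductSpace ℝ E] [MeasurableSpace E]

/-- A measure carried by the unit sphere and invariant under all linear isometries. -/
structure IsRotationInvariant (μ : Measure E) : Prop where
  ae_norm : ∀ᵐ x ∂μ, ‖x‖ = 1
  measurePreserving : ∀ g : E ≃ₗᵢ[ℝ] E, MeasurePreserving g μ μ

variable {μ : Measure E}

lemma ae_pi_norm_eq_one {ι : Type*} [Fintype ι] [IsProbabilityMeasure μ] (hμ : IsRotationInvariant μ) :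
    ∀ᵐ y ∂Measure.pi fun _ : ι => μ, ∀ i, ‖y i‖ = 1 :=
  ae_all_iff.2 fun i =>
    (measurePreserving_eval (fun _ : ι => μ) i).quasiMeasurePreserving.ae hμ.ae_norm

variable [BorelSpace E]

lemma IsRotationInvariant.measure_ball_congr (hμ : IsRotationInvariant μ) {x y : E}
    (hxy : ‖x‖ = ‖y‖) (r : ℝ) : μ (Metric.ball x r) = μ (Metric.ball y r) := by
  set g : E ≃ₗᵢ[ℝ] E := (ℝ ∙ (x - y))ᗮ.reflection
  have hg : g x = y := Submodule.reflection_sub hxy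
  rw [← (hμ.measurePreserving g).measure_preimage
      (s := Metric.ball y r) Metric.isOpen_ball.measurableSet.nullMeasurableSet,
    LinearIsometryEquiv.preimage_ball, ← hg, LinearIsometryEquiv.symm_apply_apply]

lemma IsRotationInvariant.measure_ball_le (hμ : IsRotationInvariant μ) {e : E} (he : ‖e‖ = 1)
    (z : E) (r : ℝ) : μ (Metric.ball z r) ≤ μ (Metric.ball e (2 * r)) := by
  by_cases h : ∃ x, ‖x‖ = 1 ∧ x ∈ Metric.ball z r
  · obtain ⟨x, hx, hxz⟩ := h
    rw [← hμ.measure_ball_congr (hx.trans he.symm) (2 * r)]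
    refine measure_mono fun y hy => ?_
    rw [Metric.mem_ball] at *
    linarith [dist_triangle_right y x z]
  · push Not at h
    have : μ (Metric.ball z r) = 0 := by
      rw [measure_eq_zero_iff_ae_notMem]
      filter_upwards [hμ.ae_norm] with x hx using h x hx
    simp [this]

variable [FiniteDimensional ℝ E]

lemma volume_preimage_affine_ball (c y : E) {r : ℝ} (hr : 0 < r) :
    volume {u : E | y ∈ Metric.ball (c + r • u) r} = volume (Metric.ball (0 : E) 1) := by
  have : {u : E | y ∈ Metric.ball (c + r • u) r} = Metric.ball (r⁻¹ • (y - c)) 1 := by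
    ext u
    have h : y - (c + r • u) = r • (r⁻¹ • (y - c) - u) := by
      rw [smul_sub, smul_inv_smul₀ hr.ne']; abel
    rw [Set.mem_ofPred_eq, Metric.mem_ball, Metric.mem_ball, dist_eq_norm, h, norm_smul,
      dist_comm, dist_eq_norm, Real.norm_of_nonneg hr.le]
    exact mul_lt_iff_lt_one_right hr
  rw [this]
  simpa using Measure.addHaar_ball_center (volume : Measure E) (r⁻¹ • (y - c)) 1

/-- Averaging over balls of radius `r` whose centre moves over the whole space. -/
lemma lintegral_mul_volume_ball [SFinite μ] {f : E → ENNReal} (hf : Measurable f) (c : E) {r : ℝ}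
    (hr : 0 < r) : (∫⁻ y, f y ∂μ) * volume (Metric.ball (0 : E) 1) =
      ∫⁻ u : E, ∫⁻ y in Metric.ball (c + r • u) r, f y ∂μ := by
  have hS : MeasurableSet {p : E × E | p.1 ∈ Metric.ball (c + r • p.2) r} := by
    simp only [Metric.mem_ball]
    exact measurableSet_lt (by fun_prop) measurable_const
  have hmeas : Measurable (Function.uncurry fun y u : E =>
      (Metric.ball (c + r • u) r).indicator f y) := by
    have : (Function.uncurry fun y u : E => (Metric.ball (c + r • u) r).indicator f y) =
        {p : E × E | p.1 ∈ Metric.ball (c + r • p.2) r}.indicator (fun p => f p.1) := by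
      ext ⟨y, u⟩; simp [Set.indicator]
    rw [this]
    exact (hf.comp measurable_fst).indicator hS
  simp_rw [← lintegral_indicator Metric.isOpen_ball.measurableSet]
  rw [← lintegral_lintegral_swap hmeas.aemeasurable, ← lintegral_mul_const _ hf]
  refine lintegral_congr fun y => ?_
  have : (fun u : E => (Metric.ball (c + r • u) r).indicator f y) =
      {u : E | y ∈ Metric.ball (c + r • u) r}.indicator (fun _ => f y) := by
    ext u; simp [Set.indicator]
  have hSy : MeasurableSet {u : E | y ∈ Metric.ball (c + r • u) r} := measurable_prodMk_left hS
  rw [this, lintegral_indicator_const hSy, volume_preimage_affine_ball _ _ hr]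

/-- A cap of radius `2r` of the sphere has measure at least of order `r^(dim - 1)`. -/
lemma IsRotationInvariant.le_measureReal_ball [Nontrivial E] [IsProbabilityMeasure μ]
    (hμ : IsRotationInvariant μ) {e : E} (he : ‖e‖ = 1) {r : ℝ} (hr : 0 < r) (hr1 : r ≤ 1) :
    r ^ (Module.finrank ℝ E - 1) ≤
      (Module.finrank ℝ E * 2 ^ Module.finrank ℝ E) * μ.real (Metric.ball e (2 * r)) := by
  set d := Module.finrank ℝ E with hd_def
  have hd : 1 ≤ d := Module.finrank_pos
  have hR : 1 ≤ r⁻¹ := (one_le_inv₀ hr).2 hr1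
  set V := volume (Metric.ball (0 : E) 1)
  have hV0 : V ≠ 0 := (Metric.measure_ball_pos _ _ one_pos).ne'
  have hVt : V ≠ ⊤ := measure_ball_lt_top.ne
  set S : Set E := Metric.ball 0 (r⁻¹ + 1) \ Metric.ball 0 (r⁻¹ - 1)
  have hSm : MeasurableSet S := Metric.isOpen_ball.measurableSet.diff Metric.isOpen_ball.measurableSet
  have h1 : V ≤ volume S * μ (Metric.ball e (2 * r)) := by
    have := lintegral_mul_volume_ball (μ := μ) (f := fun _ => 1) measurable_const (0 : E) hr
    simp only [lintegral_const, measure_univ, mul_one, one_mul, zero_add,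
      Measure.restrict_apply_univ] at this
    calc V = ∫⁻ u : E, μ (Metric.ball (r • u) r) := this
      _ ≤ ∫⁻ u : E, S.indicator (fun _ => μ (Metric.ball e (2 * r))) u := by
          refine lintegral_mono fun u => ?_
          by_cases hu : u ∈ S
          · simpa [hu] using hμ.measure_ball_le he _ _
          · simp only [hu, not_false_eq_true, Set.indicator_of_notMem, nonpos_iff_eq_zero]
            rw [measure_eq_zero_iff_ae_notMem]
            filter_upwards [hμ.ae_norm] with x hx hxu
            apply hu
            rw [Metric.mem_ball, dist_eq_norm] at hxu
            have h2 := abs_lt.1 ((abs_norm_sub_norm_le x (r • u)).trans_lt hxu)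
            rw [hx, norm_smul, Real.norm_of_nonneg hr.le] at h2
            have h3 : r * r⁻¹ = 1 := mul_inv_cancel₀ hr.ne'
            simp only [S, Set.mem_sdiff, Metric.mem_ball, dist_zero_right, not_lt]
            constructor
            · by_contra! h; nlinarith
            · by_contra! h; nlinarith
      _ = _ := by rw [lintegral_indicator_const hSm, mul_comm]
  have h2 : volume S = ENNReal.ofReal ((r⁻¹ + 1) ^ d - (r⁻¹ - 1) ^ d) * V := by
    rw [measure_sdiff (Metric.ball_subset_ball (by linarith))
      Metric.isOpen_ball.measurableSet.nullMeasurableSet measure_ball_lt_top.ne,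
      Measure.addHaar_ball _ _ (by linarith : 0 ≤ r⁻¹ + 1),
      Measure.addHaar_ball _ _ (by linarith : 0 ≤ r⁻¹ - 1),
      ENNReal.ofReal_sub _ (by have := sub_nonneg.2 hR; positivity),
      ENNReal.sub_mul (fun _ _ => hVt)]
  have h3 : 1 ≤ ENNReal.ofReal ((r⁻¹ + 1) ^ d - (r⁻¹ - 1) ^ d) * μ (Metric.ball e (2 * r)) := by
    rw [h2, mul_right_comm] at h1
    exact (ENNReal.mul_le_mul_iff_left hV0 hVt).1 (by simpa using h1)
  have h4 : (r⁻¹ + 1) ^ d - (r⁻¹ - 1) ^ d ≤ d * 2 ^ d * r⁻¹ ^ (d - 1) := by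
    have := abs_pow_sub_pow_le (r⁻¹ + 1) (r⁻¹ - 1) d
    rw [abs_of_nonneg (by linarith : (0:ℝ) ≤ r⁻¹ + 1), abs_of_nonneg (by linarith : (0:ℝ) ≤ r⁻¹ - 1),
      max_eq_left (by linarith)] at this
    calc _ ≤ _ := (le_abs_self _).trans this
      _ ≤ 2 * d * (2 * r⁻¹) ^ (d - 1) := by
        rw [show (r⁻¹ + 1) - (r⁻¹ - 1) = 2 by ring, abs_two]
        gcongr; linarith
      _ = _ := by
        rw [mul_pow, ← Nat.sub_add_cancel hd]; simp only [Nat.add_sub_cancel]; ring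
  have h5 : 1 ≤ ((r⁻¹ + 1) ^ d - (r⁻¹ - 1) ^ d) * μ.real (Metric.ball e (2 * r)) := by
    have := ENNReal.toReal_mono (ENNReal.mul_ne_top ENNReal.ofReal_ne_top (measure_ne_top _ _)) h3
    rwa [ENNReal.toReal_one, ENNReal.toReal_mul, ENNReal.toReal_ofReal] at this
    exact sub_nonneg.2 (pow_le_pow_left₀ (by linarith) (by linarith) _)
  have h6 := h5.trans (mul_le_mul_of_nonneg_right h4 measureReal_nonneg)
  have hrp : 0 < r ^ (d - 1) := by positivity
  calc r ^ (d - 1) = r ^ (d - 1) * 1 := (mul_one _).symm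
    _ ≤ r ^ (d - 1) * (d * 2 ^ d * r⁻¹ ^ (d - 1) * μ.real (Metric.ball e (2 * r))) := by gcongr
    _ = _ := by rw [inv_pow]; field_simp

variable (E) in
/-- Functions with polynomial decay at scale `r` around `e` have integral at most of the order of
the measure of the cap of radius `2r`. -/
lemma exists_integral_le_measureReal_ball :
    ∃ A : ℝ, 0 < A ∧ ∀ (μ : Measure E) [IsProbabilityMeasure μ], IsRotationInvariant μ →
      ∀ e : E, ‖e‖ = 1 → ∀ r : ℝ, 0 < r → ∀ f : E → ℝ, Measurable f → (∀ y, 0 ≤ f y) →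
      (∀ y, f y ≤ (2 + ‖y - e‖ / r) ^ (-(Module.finrank ℝ E + 1 : ℝ))) →
      ∫ y, f y ∂μ ≤ A * μ.real (Metric.ball e (2 * r)) := by
  set d := Module.finrank ℝ E with hd_def
  set V := volume (Metric.ball (0 : E) 1)
  have hV0 : V ≠ 0 := (Metric.measure_ball_pos _ _ one_pos).ne'
  have hVt : V ≠ ⊤ := measure_ball_lt_top.ne
  set J := ∫⁻ u : E, ENNReal.ofReal ((1 + ‖u‖) ^ (-(d + 1 : ℝ)))
  have hJ : J ≠ ⊤ := (finite_integral_one_add_norm (μ := volume) (by simp [hd_def])).ne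
  refine ⟨(J / V).toReal + 1, by positivity, fun μ _ hμ e he r hr f hf hf0 hfb => ?_⟩
  have h1 : (∫⁻ y, ENNReal.ofReal (f y) ∂μ) * V ≤ J * μ (Metric.ball e (2 * r)) := by
    rw [lintegral_mul_volume_ball hf.ennreal_ofReal e hr, ← lintegral_mul_const _ (by fun_prop)]
    refine lintegral_mono fun u => ?_
    refine le_trans (setLIntegral_mono (g := fun _ => ENNReal.ofReal ((1 + ‖u‖) ^ (-(d + 1 : ℝ))))
      measurable_const fun y hy => ENNReal.ofReal_le_ofReal ((hfb y).trans ?_)) ?_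
    · refine Real.rpow_le_rpow_of_nonpos (by positivity) ?_ (by linarith [d.cast_nonneg (α := ℝ)])
      rw [Metric.mem_ball, dist_eq_norm] at hy
      have h2 : ‖r • u‖ ≤ ‖y - e‖ + ‖y - (e + r • u)‖ := by
        calc ‖r • u‖ = ‖(y - e) - (y - (e + r • u))‖ := by congr 1; abel
          _ ≤ _ := norm_sub_le _ _
      rw [norm_smul, Real.norm_of_nonneg hr.le] at h2
      have : ‖u‖ ≤ ‖y - e‖ / r + 1 := by
        rw [div_add_one hr.ne', le_div_iff₀ hr]; linarith
      linarith
    · rw [setLIntegral_const]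
      exact mul_le_mul_right (hμ.measure_ball_le he _ _) _
  have h2 : (∫⁻ y, ENNReal.ofReal (f y) ∂μ) ≤ J / V * μ (Metric.ball e (2 * r)) := by
    rw [← ENNReal.le_div_iff_mul_le (.inl hV0) (.inl hVt)] at h1
    refine h1.trans_eq ?_
    rw [div_eq_mul_inv, div_eq_mul_inv, mul_right_comm]
  rw [integral_eq_lintegral_of_nonneg_ae (.of_forall hf0) hf.aestronglyMeasurable]
  have hfin : J / V ≠ ⊤ := ENNReal.div_ne_top hJ hV0
  refine (ENNReal.toReal_mono (ENNReal.mul_ne_top hfin (measure_ne_top _ _)) h2).trans ?_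
  rw [ENNReal.toReal_mul]
  exact mul_le_mul_of_nonneg_right (by linarith) ENNReal.toReal_nonneg

section SoftmaxIntegrals

variable {ι : Type*} [Fintype ι]

/-- Reflecting a single sample through the axis `e` flips the sign of its transversal part. -/
lemma integral_softmaxWeight_mul_inner_eq_zero [IsProbabilityMeasure μ]
    (hμ : IsRotationInvariant μ) (w : ℝ) {e : E} (he : ‖e‖ = 1) {i j : ι} (hij : i ≠ j) :
    ∫ y, softmaxWeight w e y i * softmaxWeight w e y j *
      inner ℝ (y i - (inner ℝ e (y i) : ℝ) • e) (y j - (inner ℝ e (y j) : ℝ) • e)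
      ∂(Measure.pi fun _ : ι => μ) = 0 := by
  classical
  set R : E ≃ₗᵢ[ℝ] E := (ℝ ∙ e).reflection
  have hR : ∀ y, R y = (2 * inner ℝ e y : ℝ) • e - y := fun y => by
    simp only [R, Submodule.reflection_singleton_apply, he]
    simp only [Real.ringHom_apply, one_pow, div_one]
    module
  have hRe : R e = e := by
    rw [hR, real_inner_self_eq_norm_sq, he]; module
  have hRn : ∀ y, ‖R y - e‖ = ‖y - e‖ := fun y => by
    conv_lhs => rw [← hRe, ← map_sub, LinearIsometryEquiv.norm_map]
  have hRi : ∀ y, inner ℝ e (R y) = (inner ℝ e y : ℝ) := fun y => by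
    rw [hR, inner_sub_right, inner_smul_right, real_inner_self_eq_norm_sq, he]; ring
  set F : (k : ι) → E → E := fun k => if k = i then R else id
  have hF : MeasurePreserving (fun (y : ι → E) k => F k (y k)) (Measure.pi fun _ : ι => μ)
      (Measure.pi fun _ : ι => μ) := by
    refine measurePreserving_pi _ _ fun k => ?_
    by_cases hk : k = i
    · simp only [F, hk, if_true]; exact hμ.measurePreserving R
    · simp only [F, hk, if_false]; exact MeasurePreserving.id _
  set h : (ι → E) → ℝ := fun y => softmaxWeight w e y i * softmaxWeight w e y j *
      inner ℝ (y i - (inner ℝ e (y i) : ℝ) • e) (y j - (inner ℝ e (y j) : ℝ) • e) with h_def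
  have hm : Measurable h := by fun_prop
  have hFn : ∀ k y, ‖F k y - e‖ = ‖y - e‖ := fun k y => by
    by_cases hk : k = i <;> simp [F, hk, hRn]
  have hh : ∀ y, h (fun k => F k (y k)) = -h y := fun y => by
    have hs : ∀ k, softmaxWeight w e (fun k => F k (y k)) k = softmaxWeight w e y k := fun k => by
      simp only [softmaxWeight, hFn]
    have hi : F i (y i) - (inner ℝ e (F i (y i)) : ℝ) • e = -(y i - (inner ℝ e (y i) : ℝ) • e) := by
      have hFi : F i (y i) = R (y i) := by simp [F]
      rw [hFi, hRi, hR]; module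
    have hj : F j (y j) = y j := by simp [F, hij.symm]
    simp only [h_def, hs, hi, hj, inner_neg_left, mul_neg]
  have h1 : ∫ y, h y ∂(Measure.pi fun _ : ι => μ) = -∫ y, h y ∂(Measure.pi fun _ : ι => μ) := by
    conv_lhs => rw [← hF.map_eq, integral_map hF.measurable.aemeasurable hm.aestronglyMeasurable]
    simp_rw [hh]
    exact integral_neg _
  linarith

lemma integral_norm_sum_transversal_sq [Nonempty ι] [IsProbabilityMeasure μ]
    (hμ : IsRotationInvariant μ) (w : ℝ) {e : E} (he : ‖e‖ = 1) :
    ∫ y, ‖∑ i, softmaxWeight w e y i • (y i - (inner ℝ e (y i) : ℝ) • e)‖ ^ 2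
      ∂(Measure.pi fun _ : ι => μ) =
    ∫ y, ∑ i, softmaxWeight w e y i ^ 2 * ‖y i - (inner ℝ e (y i) : ℝ) • e‖ ^ 2
      ∂(Measure.pi fun _ : ι => μ) := by
  have hint : ∀ i j : ι, Integrable (fun y => softmaxWeight w e y i * softmaxWeight w e y j *
      inner ℝ (y i - (inner ℝ e (y i) : ℝ) • e) (y j - (inner ℝ e (y j) : ℝ) • e))
      (Measure.pi fun _ : ι => μ) := fun i j => by
    refine Integrable.of_bound (Measurable.aestronglyMeasurable (by fun_prop)) 1 ?_
    filter_upwards [ae_pi_norm_eq_one hμ] with y hy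
    have hp : ∀ k, ‖y k - (inner ℝ e (y k) : ℝ) • e‖ ≤ 1 := fun k => by
      rw [← sq_le_one_iff₀ (norm_nonneg _), norm_sub_inner_smul_sq he, hy]
      nlinarith [sq_nonneg (inner ℝ e (y k) : ℝ)]
    have hw : ∀ k, ‖softmaxWeight w e y k‖ ≤ 1 := fun k => by
      rw [Real.norm_of_nonneg (softmaxWeight_nonneg ..)]; exact softmaxWeight_le_one ..
    rw [norm_mul, norm_mul]
    exact mul_le_one₀ (mul_le_one₀ (hw i) (norm_nonneg _) (hw j)) (norm_nonneg _)
      ((norm_inner_le_norm _ _).trans (mul_le_one₀ (hp i) (norm_nonneg _) (hp j)))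
  simp_rw [norm_sum_smul_sq]
  rw [integral_finsetSum _ fun i _ => integrable_finsetSum _ fun j _ => hint i j]
  have hdiag : ∀ i : ι, ∀ y : ι → E,
      softmaxWeight w e y i ^ 2 * ‖y i - (inner ℝ e (y i) : ℝ) • e‖ ^ 2 =
      softmaxWeight w e y i * softmaxWeight w e y i *
      inner ℝ (y i - (inner ℝ e (y i) : ℝ) • e) (y i - (inner ℝ e (y i) : ℝ) • e) := fun i y => by
    rw [real_inner_self_eq_norm_sq, sq (softmaxWeight w e y i)]
  simp_rw [hdiag]
  rw [integral_finsetSum _ fun i _ => hint i i]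
  refine Finset.sum_congr rfl fun i _ => ?_
  rw [integral_finsetSum _ fun j _ => hint i j]
  exact Finset.sum_eq_single i
    (fun j _ hj => integral_softmaxWeight_mul_inner_eq_zero hμ w he hj.symm) (by simp)

end SoftmaxIntegrals

variable (E) in
/-- Gaussian moments around a point of the sphere are controlled by the measure of a cap. -/
lemma exists_gaussian_moment_le :
    ∃ M : ℝ, 0 < M ∧ ∀ (μ : Measure E) [IsProbabilityMeasure μ], IsRotationInvariant μ →
      ∀ e : E, ‖e‖ = 1 → ∀ w : ℝ, 0 < w →
      ∫ y, Real.exp (-w * ‖y - e‖ ^ 2) * ‖y - e‖ ^ 4 ∂μ ≤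
        M / w ^ 2 * μ.real (Metric.ball e (2 * (√w)⁻¹)) ∧
      ∫ y, Real.exp (-w * ‖y - e‖ ^ 2) ^ 2 * ‖y - e‖ ^ 2 ∂μ ≤
        M / w * μ.real (Metric.ball e (2 * (√w)⁻¹)) := by
  obtain ⟨A, hA, hAE⟩ := exists_integral_le_measureReal_ball E
  set d := Module.finrank ℝ E
  set B : ℝ := (d + 5).factorial * Real.exp 3
  have hB : 0 < B := by positivity
  refine ⟨B * A, by positivity, fun μ _ hμ e he w hw => ?_⟩
  have hr : 0 < (√w)⁻¹ := by positivity
  have key : ∀ c : ℝ, 0 < c → ∀ f : E → ℝ, Measurable f → (∀ y, 0 ≤ f y) →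
      (∀ y, c * f y ≤ (2 + ‖y - e‖ / (√w)⁻¹) ^ 4 * Real.exp (-(‖y - e‖ / (√w)⁻¹) ^ 2)) →
      ∫ y, f y ∂μ ≤ B * A / c * μ.real (Metric.ball e (2 * (√w)⁻¹)) := by
    intro c hc f hf hf0 hfb
    have := hAE μ hμ e he _ hr (fun y => B⁻¹ * (c * f y)) (by fun_prop)
      (fun y => by have := hf0 y; positivity) (fun y => by
        rw [inv_mul_le_iff₀ hB]
        exact (hfb y).trans (two_add_pow_mul_exp_neg_sq_le d (by positivity)))
    rw [integral_const_mul, integral_const_mul, inv_mul_le_iff₀ hB] at this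
    rw [div_mul_eq_mul_div, le_div_iff₀' hc]
    linarith
  have ht : ∀ y : E, (‖y - e‖ / (√w)⁻¹) ^ 2 = w * ‖y - e‖ ^ 2 := fun y => by
    rw [div_inv_eq_mul, mul_pow, Real.sq_sqrt hw.le, mul_comm]
  constructor
  · refine key (w ^ 2) (by positivity) _ (by fun_prop) (fun y => by positivity) fun y => ?_
    rw [← neg_mul_eq_neg_mul, ← ht]
    have ht0 : 0 ≤ ‖y - e‖ / (√w)⁻¹ := by positivity
    calc _ = (w * ‖y - e‖ ^ 2) ^ 2 * Real.exp (-(‖y - e‖ / (√w)⁻¹) ^ 2) := by ring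
      _ = (‖y - e‖ / (√w)⁻¹) ^ 4 * Real.exp (-(‖y - e‖ / (√w)⁻¹) ^ 2) := by rw [← ht]; ring
      _ ≤ _ := by gcongr; linarith
  · refine key w hw _ (by fun_prop) (fun y => by positivity) fun y => ?_
    rw [← neg_mul_eq_neg_mul, ← ht]
    set t := ‖y - e‖ / (√w)⁻¹
    have ht0 : 0 ≤ t := by positivity
    have hexp : Real.exp (-t ^ 2) ≤ 1 := Real.exp_le_one_iff.2 (by nlinarith [sq_nonneg t])
    have hpow : t ^ 2 ≤ (2 + t) ^ 4 := by nlinarith [sq_nonneg t, sq_nonneg (2 + t)]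
    calc _ = (w * ‖y - e‖ ^ 2) * Real.exp (-t ^ 2) ^ 2 := by ring
      _ = t ^ 2 * (Real.exp (-t ^ 2) * Real.exp (-t ^ 2)) := by rw [← ht, sq (Real.exp _)]
      _ ≤ t ^ 2 * (1 * Real.exp (-t ^ 2)) := by gcongr
      _ ≤ _ := by rw [one_mul]; gcongr

lemma integral_norm_sum_sq_eq {ι : Type*} [Fintype ι] [Nonempty ι] [IsProbabilityMeasure μ]
    (hμ : IsRotationInvariant μ) (w : ℝ) {e : E} (he : ‖e‖ = 1) :
    ∫ y, ‖∑ i, softmaxWeight w e y i • (e - y i)‖ ^ 2 ∂(Measure.pi fun _ : ι => μ) =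
    ∫ y, ((∑ i, softmaxWeight w e y i * (1 - inner ℝ e (y i))) ^ 2 +
      ∑ i, softmaxWeight w e y i ^ 2 * ‖y i - (inner ℝ e (y i) : ℝ) • e‖ ^ 2)
      ∂(Measure.pi fun _ : ι => μ) := by
  have hbound : ∀ y : ι → E, (∀ i, ‖y i‖ = 1) →
      (∑ i, softmaxWeight w e y i * (1 - inner ℝ e (y i))) ^ 2 +
        ‖∑ i, softmaxWeight w e y i • (y i - inner ℝ e (y i) • e)‖ ^ 2 ≤ 4 := fun y hy => by
    rw [← norm_sum_smul_sub_sq he]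
    nlinarith [norm_sum_softmaxWeight_smul_le w he hy,
      norm_nonneg (∑ i, softmaxWeight w e y i • (e - y i))]
  have h1 : Integrable (fun y : ι → E =>
      (∑ i, softmaxWeight w e y i * (1 - inner ℝ e (y i) : ℝ)) ^ 2)
      (Measure.pi fun _ : ι => μ) := by
    refine Integrable.of_bound (Measurable.aestronglyMeasurable (by fun_prop)) 4 ?_
    filter_upwards [ae_pi_norm_eq_one hμ] with y hy
    rw [Real.norm_of_nonneg (sq_nonneg _)]
    exact (le_add_of_nonneg_right (sq_nonneg _)).trans (hbound y hy)
  have h2 : Integrable (fun y : ι → E =>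
      ‖∑ i, softmaxWeight w e y i • (y i - (inner ℝ e (y i) : ℝ) • e)‖ ^ 2)
      (Measure.pi fun _ : ι => μ) := by
    refine Integrable.of_bound (Measurable.aestronglyMeasurable (by fun_prop)) 4 ?_
    filter_upwards [ae_pi_norm_eq_one hμ] with y hy
    rw [Real.norm_of_nonneg (sq_nonneg _)]
    exact (le_add_of_nonneg_left (sq_nonneg _)).trans (hbound y hy)
  have h3 : Integrable (fun y : ι → E =>
      ∑ i, softmaxWeight w e y i ^ 2 * ‖y i - (inner ℝ e (y i) : ℝ) • e‖ ^ 2)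
      (Measure.pi fun _ : ι => μ) := by
    refine integrable_finsetSum _ fun i _ =>
      Integrable.of_bound (Measurable.aestronglyMeasurable (by fun_prop)) 1 ?_
    filter_upwards [ae_pi_norm_eq_one hμ] with y hy
    rw [Real.norm_of_nonneg (by positivity), norm_sub_inner_smul_sq he, hy]
    refine mul_le_one₀ ?_ ?_ (by nlinarith [sq_nonneg (inner ℝ e (y i) : ℝ)])
    · exact pow_le_one₀ (softmaxWeight_nonneg ..) (softmaxWeight_le_one ..)
    · rw [← hy i, ← norm_sub_inner_smul_sq he]; positivity
  simp_rw [norm_sum_smul_sub_sq he]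
  rw [integral_add h1 h2, integral_add h1 h3, integral_norm_sum_transversal_sq hμ w he]

variable (E) in
/-- Mean squared distance between the softmax average of a sample and the query point. -/
lemma exists_integral_norm_sum_sq_le [Nontrivial E] :
    ∃ C : ℝ, 0 < C ∧ ∀ (μ : Measure E) [IsProbabilityMeasure μ], IsRotationInvariant μ →
      ∀ e : E, ‖e‖ = 1 → ∀ w : ℝ, 1 ≤ w → ∀ n : ℕ, √w ^ Module.finrank ℝ E ≤ n →
      ∫ y, ‖∑ i, softmaxWeight w e y i • (e - y i)‖ ^ 2 ∂(Measure.pi fun _ : Fin n => μ) ≤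
        C * (1 / w ^ 2 + √w ^ Module.finrank ℝ E / (w * n)) := by
  obtain ⟨M, hM, hME⟩ := exists_gaussian_moment_le E
  set d := Module.finrank ℝ E
  have hd : 0 < d := Module.finrank_pos
  set κ : ℝ := d * 2 ^ d
  have hκ : 0 < κ := by positivity
  refine ⟨Real.exp 4 * M + 16 * Real.exp 4 ^ 2 * M * κ + 8 * 24 * 256 * κ ^ 4, by positivity,
    fun μ _ hμ e he w hw n hn => ?_⟩
  have hw0 : 0 < w := by linarith
  have hs1 : 1 ≤ √w := Real.one_le_sqrt.2 hw
  have hs0 : 0 < √w := by linarith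
  have hn0 : (0 : ℝ) < n := lt_of_lt_of_le (by positivity) hn
  have : Nonempty (Fin n) := ⟨⟨0, by exact_mod_cast hn0⟩⟩
  obtain ⟨hm1, hm2⟩ := hME μ hμ e he w hw0
  have hm3 := integral_exp_neg_gaussian_le (μ := μ) e hw0
  have hq := hμ.le_measureReal_ball he (inv_pos.2 hs0) (inv_le_one_of_one_le₀ hs1)
  set q := μ.real (Metric.ball e (2 * (√w)⁻¹))
  have hqκ : 1 ≤ κ * q * √w ^ (d - 1) := by
    rw [inv_pow, inv_le_iff_one_le_mul₀ (by positivity)] at hq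
    exact hq
  have hq0 : 0 < q := by
    by_contra! h
    have : κ * q * √w ^ (d - 1) ≤ 0 :=
      mul_nonpos_of_nonpos_of_nonneg (mul_nonpos_of_nonneg_of_nonpos hκ.le h) (by positivity)
    linarith
  set δ : ℝ := n * q / (4 * Real.exp 4)
  have hδ : 0 < δ := by positivity
  have hδ' : Real.exp 4 * δ = n * q / 4 := by simp only [δ]; field_simp
  have hle : ∀ᵐ y ∂μ, ‖y - e‖ ≤ 2 := by
    filter_upwards [hμ.ae_norm] with y hy
    exact (norm_sub_le _ _).trans (by rw [hy, he]; norm_num)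
  have hexp1 : ∀ y : E, Real.exp (-w * ‖y - e‖ ^ 2) ≤ 1 := fun y =>
    Real.exp_le_one_iff.2 (by rw [neg_mul]; exact neg_nonpos.2 (by positivity))
  have hi1 : Integrable (fun y => Real.exp (-w * ‖y - e‖ ^ 2) * ‖y - e‖ ^ 4) μ := by
    refine Integrable.of_bound (Measurable.aestronglyMeasurable (by fun_prop)) (1 * 2 ^ 4) ?_
    filter_upwards [hle] with y hy
    rw [Real.norm_of_nonneg (by positivity)]
    gcongr
    exact hexp1 y
  have hi2 : Integrable (fun y => Real.exp (-w * ‖y - e‖ ^ 2) ^ 2 * ‖y - e‖ ^ 2) μ := by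
    refine Integrable.of_bound (Measurable.aestronglyMeasurable (by fun_prop)) (1 ^ 2 * 2 ^ 2) ?_
    filter_upwards [hle] with y hy
    rw [Real.norm_of_nonneg (by positivity)]
    gcongr
    exact hexp1 y
  have hi3 : Integrable (fun y => Real.exp (-Real.exp 4 * Real.exp (-w * ‖y - e‖ ^ 2))) μ := by
    refine Integrable.of_bound (Measurable.aestronglyMeasurable (by fun_prop)) 1
      (.of_forall fun y => ?_)
    rw [Real.norm_of_nonneg (Real.exp_pos _).le]
    exact Real.exp_le_one_iff.2 (by rw [neg_mul]; exact neg_nonpos.2 (by positivity))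
  have hI1 := (integrable_finsetSum Finset.univ fun i _ =>
    integrable_comp_eval (μ := fun _ : Fin n => μ) (i := i) hi1).const_mul (4 * δ)⁻¹
  have hI2 := (integrable_finsetSum Finset.univ fun i _ =>
    integrable_comp_eval (μ := fun _ : Fin n => μ) (i := i) hi2).const_mul (δ ^ 2)⁻¹
  have hI3 := (Integrable.fintype_prod (μ := fun _ : Fin n => μ) fun _ => hi3).const_mul
    (8 * Real.exp (Real.exp 4 * δ))
  have hmain : ∫ y, ‖∑ i, softmaxWeight w e y i • (e - y i)‖ ^ 2 ∂(Measure.pi fun _ : Fin n => μ) ≤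
      (4 * δ)⁻¹ * (n * (M / w ^ 2 * q)) + (δ ^ 2)⁻¹ * (n * (M / w * q)) +
        8 * Real.exp (Real.exp 4 * δ) * Real.exp (-(q / 2)) ^ n := by
    rw [integral_norm_sum_sq_eq hμ w he]
    refine (integral_mono_of_nonneg (.of_forall fun y => by positivity) ((hI1.add hI2).add hI3)
      ?_).trans ?_
    · filter_upwards [ae_pi_norm_eq_one hμ] with y hy
      exact sum_sq_add_sum_le he hy w (Real.exp_pos 4).le hδ
    · rw [integral_add' (hI1.add hI2) hI3, integral_add' hI1 hI2, integral_const_mul,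
        integral_const_mul, integral_const_mul, integral_sum_comp_eval hi1,
        integral_sum_comp_eval hi2,
        integral_fintype_prod_eq_prod (μ := fun _ : Fin n => μ)
          (fun _ y => Real.exp (-Real.exp 4 * Real.exp (-w * ‖y - e‖ ^ 2)))]
      simp only [Fintype.card_fin, Finset.prod_const, Finset.card_univ]
      gcongr
  have hsd : √w ^ d = √w ^ (d - 1) * √w := (pow_sub_one_mul hd.ne' _).symm
  have ht1 : (4 * δ)⁻¹ * (n * (M / w ^ 2 * q)) = Real.exp 4 * M * (1 / w ^ 2) := by
    simp only [δ]; field_simp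
  have ht2 : (δ ^ 2)⁻¹ * (n * (M / w * q)) ≤
      16 * Real.exp 4 ^ 2 * M * κ * (√w ^ d / (w * n)) := by
    have h1 : 1 / q ≤ κ * √w ^ d := by
      rw [div_le_iff₀ hq0, hsd]
      calc 1 ≤ κ * q * √w ^ (d - 1) * 1 := by rwa [mul_one]
        _ ≤ κ * q * √w ^ (d - 1) * √w := by gcongr
        _ = _ := by ring
    calc _ = 16 * Real.exp 4 ^ 2 * M / (w * n) * (1 / q) := by simp only [δ]; field_simp; ring
      _ ≤ 16 * Real.exp 4 ^ 2 * M / (w * n) * (κ * √w ^ d) := by gcongr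
      _ = _ := by ring
  have ht3 : 8 * Real.exp (Real.exp 4 * δ) * Real.exp (-(q / 2)) ^ n ≤
      8 * 24 * 256 * κ ^ 4 * (1 / w ^ 2) := by
    have hx : √w ≤ κ * (n * q) := by
      calc √w = 1 * √w := (one_mul _).symm
        _ ≤ κ * q * √w ^ (d - 1) * √w := by gcongr
        _ = κ * (√w ^ d * q) := by rw [hsd]; ring
        _ ≤ _ := by gcongr
    have hx4 : w ^ 2 ≤ κ ^ 4 * (n * q) ^ 4 := by
      calc w ^ 2 = √w ^ 4 := by
            rw [show √w ^ 4 = (√w ^ 2) ^ 2 by ring, Real.sq_sqrt hw0.le]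
        _ ≤ (κ * (n * q)) ^ 4 := by gcongr
        _ = _ := by ring
    have hfac := Real.pow_div_factorial_le_exp (n * q / 4) (by positivity) 4
    have he1 : Real.exp (Real.exp 4 * δ) * Real.exp (-(q / 2)) ^ n = (Real.exp (n * q / 4))⁻¹ := by
      rw [hδ', ← Real.exp_nat_mul, ← Real.exp_add, ← Real.exp_neg]
      congr 1; ring
    rw [mul_assoc, he1, mul_one_div, le_div_iff₀ (by positivity), ← div_eq_mul_inv,
      div_mul_eq_mul_div, div_le_iff₀ (Real.exp_pos _)]
    have hf4 : ((4).factorial : ℝ) = 24 := by norm_num [Nat.factorial]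
    rw [hf4] at hfac
    calc 8 * w ^ 2 ≤ 8 * (κ ^ 4 * (n * q) ^ 4) := by gcongr
      _ = 8 * 24 * 256 * κ ^ 4 * ((n * q / 4) ^ 4 / 24) := by ring
      _ ≤ _ := by gcongr
  have hX : 0 ≤ 1 / w ^ 2 := by positivity
  have hY : 0 ≤ √w ^ d / (w * n) := by positivity
  have e1 : 0 ≤ Real.exp 4 * M := by positivity
  have e2 : 0 ≤ 16 * Real.exp 4 ^ 2 * M * κ := by positivity
  have e3 : 0 ≤ 8 * 24 * 256 * κ ^ 4 := by positivity
  rw [ht1] at hmain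
  nlinarith [mul_nonneg e1 hY, mul_nonneg e2 hX, mul_nonneg e3 hY]

end RotationInvariant

lemma isRotationInvariant_sphereUniform (d : ℕ) : IsRotationInvariant (sphereUniform d) where
  ae_norm := by
    refine Measure.ae_smul_measure ?_ _
    filter_upwards [ae_restrict_mem Metric.isClosed_sphere.measurableSet] with x hx
    simpa using hx
  measurePreserving g := by
    have h := (g.toIsometryEquiv.measurePreserving_hausdorffMeasure ((d : ℝ) - 1)).restrict_preimage
      (s := Metric.sphere (0 : EuclideanSpace ℝ (Fin d)) 1) Metric.isClosed_sphere.measurableSet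
    have hs : g.toIsometryEquiv ⁻¹' Metric.sphere (0 : EuclideanSpace ℝ (Fin d)) 1 =
        Metric.sphere 0 1 := by
      ext x; simp
    rw [hs] at h
    exact h.smul_measure _

lemma ae_abs_le_unifIcc (L : ℝ) : ∀ᵐ l ∂unifIcc L, |l| ≤ L := by
  refine Measure.ae_smul_measure ?_ _
  filter_upwards [ae_restrict_mem measurableSet_Icc] with l hl
  exact abs_le.2 hl

lemma affineF_sub {d : ℕ} (θ : EuclideanSpace ℝ (Fin d) × ℝ × ℝ) (x y : EuclideanSpace ℝ (Fin d)) :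
    affineF θ x - affineF θ y = θ.2.1 * inner ℝ θ.1 (x - y) := by
  simp only [affineF, PiLp.inner_apply, RCLike.inner_apply, conj_trivial, PiLp.sub_apply]
  rw [add_sub_add_right_eq_sub, ← mul_sub, ← Finset.sum_sub_distrib]
  congr 1
  exact Finset.sum_congr rfl fun a _ => by ring

/-- The deviation of the softmax average of the first `n` points from the last one. -/
def softmaxDeviation {d n : ℕ} (w : ℝ) (x : Fin (n + 1) → EuclideanSpace ℝ (Fin d)) :
    EuclideanSpace ℝ (Fin d) :=
  ∑ i : Fin n, attnW w x i • (x (Fin.last n) - x i.castSucc)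

lemma softmaxDeviation_eq {d n : ℕ} (w : ℝ) (x : Fin (n + 1) → EuclideanSpace ℝ (Fin d)) :
    softmaxDeviation w x = ∑ i : Fin n, softmaxWeight w (x (Fin.last n)) (fun j => x j.castSucc) i •
      (x (Fin.last n) - x i.castSucc) :=
  rfl

lemma ae_softmaxDeviation_sq_le {d n : ℕ} [NeZero n] [IsProbabilityMeasure (sphereUniform d)]
    (w : ℝ) : ∀ᵐ x ∂(Measure.pi fun _ : Fin (n + 1) => sphereUniform d),
      ‖softmaxDeviation w x‖ ^ 2 ≤ 4 := by
  filter_upwards [ae_pi_norm_eq_one (isRotationInvariant_sphereUniform d)] with x hx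
  have := norm_sum_softmaxWeight_smul_le w (hx (Fin.last n)) (y := fun j : Fin n => x j.castSucc)
    (fun j => hx _)
  rw [← softmaxDeviation_eq] at this
  nlinarith [norm_nonneg (softmaxDeviation w x)]

lemma integrable_softmaxDeviation_sq {d n : ℕ} [NeZero n] [IsProbabilityMeasure (sphereUniform d)]
    (w : ℝ) : Integrable (fun x => ‖softmaxDeviation w x‖ ^ 2)
      (Measure.pi fun _ : Fin (n + 1) => sphereUniform d) := by
  have hm : Measurable fun x : Fin (n + 1) → EuclideanSpace ℝ (Fin d) =>
      ‖softmaxDeviation w x‖ ^ 2 := by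
    unfold softmaxDeviation attnW; fun_prop
  refine Integrable.of_bound hm.aestronglyMeasurable 4 ?_
  filter_upwards [ae_softmaxDeviation_sq_le w] with x hx
  rwa [Real.norm_of_nonneg (sq_nonneg _)]

lemma signalTerm_affine_le {d n : ℕ} [NeZero n] [IsProbabilityMeasure (sphereUniform d)]
    (w : ℝ) {L : ℝ} (hL : 0 < L) :
    signalTerm d n (affineTask d L) affineF w ≤
      L ^ 2 * ∫ x, ‖softmaxDeviation w x‖ ^ 2 ∂(Measure.pi fun _ : Fin (n + 1) => sphereUniform d) := by
  have := isProbabilityMeasure_unifIcc hL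
  have : IsProbabilityMeasure (affineTask d L) := by unfold affineTask; infer_instance
  have hpt : ∀ θ : EuclideanSpace ℝ (Fin d) × ℝ × ℝ, ‖θ.1‖ = 1 → |θ.2.1| ≤ L → ∀ x,
      (∑ i : Fin n, attnW w x i * (affineF θ (x (Fin.last n)) - affineF θ (x i.castSucc))) ^ 2 ≤
        L ^ 2 * ‖softmaxDeviation w x‖ ^ 2 := fun θ h1 h2 x => by
    have : ∑ i : Fin n, attnW w x i * (affineF θ (x (Fin.last n)) - affineF θ (x i.castSucc)) =
        θ.2.1 * inner ℝ θ.1 (softmaxDeviation w x) := by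
      simp only [softmaxDeviation, inner_sum, inner_smul_right, Finset.mul_sum, affineF_sub]
      exact Finset.sum_congr rfl fun i _ => by ring
    rw [this, mul_pow, ← sq_abs θ.2.1, ← sq_abs (inner ℝ θ.1 _)]
    have := abs_real_inner_le_norm θ.1 (softmaxDeviation w x)
    rw [h1, one_mul] at this
    gcongr
  have hθ : ∀ᵐ θ ∂affineTask d L, ‖θ.1‖ = 1 ∧ |θ.2.1| ≤ L := by
    refine (Measure.quasiMeasurePreserving_fst.ae (isRotationInvariant_sphereUniform d).ae_norm).and ?_
    exact Measure.quasiMeasurePreserving_snd.ae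
      (Measure.quasiMeasurePreserving_fst.ae (ae_abs_le_unifIcc L))
  refine (integral_mono_of_nonneg (.of_forall fun θ => integral_nonneg fun x => sq_nonneg _)
    (integrable_const (L ^ 2 * ∫ x, ‖softmaxDeviation w x‖ ^ 2
      ∂(Measure.pi fun _ : Fin (n + 1) => sphereUniform d))) ?_).trans_eq (by simp)
  filter_upwards [hθ] with θ hθ
  rw [← integral_const_mul]
  exact integral_mono_of_nonneg (.of_forall fun x => sq_nonneg _)
    ((integrable_softmaxDeviation_sq w).const_mul _) (.of_forall (hpt θ hθ.1 hθ.2))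

lemma integral_softmaxDeviation_sq_le {d n : ℕ} [NeZero n] [IsProbabilityMeasure (sphereUniform d)]
    (w : ℝ) {B : ℝ} (hB : ∀ e : EuclideanSpace ℝ (Fin d), ‖e‖ = 1 →
      ∫ y, ‖∑ i, softmaxWeight w e y i • (e - y i)‖ ^ 2
        ∂(Measure.pi fun _ : Fin n => sphereUniform d) ≤ B) :
    ∫ x, ‖softmaxDeviation w x‖ ^ 2 ∂(Measure.pi fun _ : Fin (n + 1) => sphereUniform d) ≤ B := by
  have hmp := measurePreserving_piFinSuccAbove (fun _ : Fin (n + 1) => sphereUniform d) (Fin.last n)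
  set g : EuclideanSpace ℝ (Fin d) × (Fin n → EuclideanSpace ℝ (Fin d)) → ℝ :=
    fun p => ‖∑ i, softmaxWeight w p.1 p.2 i • (p.1 - p.2 i)‖ ^ 2
  have hg : (fun x => ‖softmaxDeviation w x‖ ^ 2) =
      fun x => g (MeasurableEquiv.piFinSuccAbove (fun _ => EuclideanSpace ℝ (Fin d)) (Fin.last n) x) := by
    ext x
    simp [g, softmaxDeviation_eq, MeasurableEquiv.piFinSuccAbove, Fin.init_def]
  have hint := integrable_softmaxDeviation_sq (d := d) (n := n) w
  rw [hg] at hint ⊢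
  have hint' : Integrable g _ :=
    (hmp.integrable_comp_emb (MeasurableEquiv.measurableEmbedding _)).1 hint
  rw [hmp.integral_comp' g, integral_prod _ hint']
  refine (integral_mono_of_nonneg (.of_forall fun e => integral_nonneg fun y => sq_nonneg _)
    (integrable_const B) ?_).trans_eq (by simp)
  filter_upwards [(isRotationInvariant_sphereUniform d).ae_norm] with e he using hB e he

/-- Lemma 11 (signal term, affine tasks, upper bound): (i) the trivial bound `4L²` always
holds, and (ii) in the main regime the signal term is at most
`C L² (1/w² + w^{d/2-1}/n + 1/n)` for a constant `C` depending only on `d`. -/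
theorem affine_signal_upper_bound (d : ℕ) (hd : 2 ≤ d) :
    ∃ C : ℝ, 0 < C ∧
      ∀ n : ℕ, 2 ≤ n →
        (∀ w L : ℝ, 0 ≤ w → 0 < L →
          signalTerm d n (affineTask d L) affineF w ≤ 4 * L ^ 2) ∧
        (∀ w L : ℝ, 0 < L → ((d : ℝ) + Real.sqrt d) / 2 ≤ w → 5 < n →
          45 * Real.sqrt d * w ^ ((d : ℝ) / 2) ≤ (n : ℝ) / Real.log n →
          signalTerm d n (affineTask d L) affineF w ≤
            C * L ^ 2 * (1 / w ^ 2 + w ^ ((d : ℝ) / 2 - 1) / n + 1 / n)) := by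
  rcases sphereUniform_eq_zero_or_isProbabilityMeasure d with h0 | hprob
  · have h : ∀ n w L, signalTerm d n (affineTask d L) affineF w = 0 := fun n w L => by
      simp [signalTerm, affineTask, h0]
    refine ⟨1, one_pos, fun n _ => ⟨fun w L _ _ => ?_, fun w L _ hw _ _ => ?_⟩⟩
    · rw [h]; positivity
    · have : 0 ≤ w := le_trans (by positivity) hw
      rw [h]; positivity
  have : Nonempty (Fin d) := ⟨⟨0, by omega⟩⟩
  obtain ⟨C, hC, hCE⟩ := exists_integral_norm_sum_sq_le (EuclideanSpace ℝ (Fin d))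
  refine ⟨C, hC, fun n hn2 => ?_⟩
  have : NeZero n := ⟨by omega⟩
  refine ⟨fun w L _ hL => ?_, fun w L hL hw hn hwn => ?_⟩
  · refine (signalTerm_affine_le w hL).trans ?_
    rw [mul_comm]
    refine mul_le_mul_of_nonneg_right ?_ (sq_nonneg L)
    exact (integral_mono_of_nonneg (.of_forall fun x => sq_nonneg _) (integrable_const 4)
      (ae_softmaxDeviation_sq_le w)).trans_eq (by simp)
  have hd' : (2 : ℝ) ≤ d := by exact_mod_cast hd
  have hw1 : 1 ≤ w := by linarith [Real.sqrt_nonneg (d : ℝ)]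
  have hw0 : 0 < w := by linarith
  have hn' : (6 : ℝ) ≤ n := by exact_mod_cast hn
  have hpow : w ^ ((d : ℝ) / 2) = √w ^ d := by
    rw [Real.sqrt_eq_rpow, ← Real.rpow_mul_natCast hw0.le]
    congr 1; ring
  have hlog : 1 ≤ Real.log n := by
    rw [Real.le_log_iff_exp_le (by linarith)]
    linarith [Real.exp_one_lt_d9]
  have hwn' : √w ^ d ≤ n := by
    rw [hpow] at hwn
    have hsd : 1 ≤ √(d : ℝ) := Real.one_le_sqrt.2 (by linarith)
    calc √w ^ d = 1 * √w ^ d := (one_mul _).symm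
      _ ≤ 45 * √(d : ℝ) * √w ^ d := by gcongr; linarith
      _ ≤ n / Real.log n := hwn
      _ ≤ n := div_le_self (by linarith) hlog
  refine (signalTerm_affine_le w hL).trans ?_
  have hB := integral_softmaxDeviation_sq_le (d := d) (n := n) w fun e he =>
    hCE (sphereUniform d) (isRotationInvariant_sphereUniform d) e he w hw1 n
      (by rwa [finrank_euclideanSpace_fin])
  rw [finrank_euclideanSpace_fin] at hB
  have hterm : w ^ ((d : ℝ) / 2 - 1) / n = √w ^ d / (w * n) := by
    rw [Real.rpow_sub_one hw0.ne', hpow, div_div]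
  rw [hterm]
  calc _ ≤ L ^ 2 * (C * (1 / w ^ 2 + √w ^ d / (w * n))) := by gcongr
    _ = C * L ^ 2 * (1 / w ^ 2 + √w ^ d / (w * n) + 0) := by ring
    _ ≤ _ := by gcongr; positivity
end
end
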